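/- arXiv:0911.5390 — 7 statements merged into one kernel-verified Lean document; each statement's English description precedes it below -/
import Mathlib

section
/- Let b ∈ {2,…,s−1} and m ∈ {1,…,s−1}, and let (i_1,…,i_m) ∈ B(m^1) be an admissible row. Suppose there are positions j < k such that either (i_j, i_k) = (b, \overline{b+1}) or (i_j, i_k) = (b+1, b̄), and no entry of the row other than i_j and i_k belongs to the set {b, b+1, \overline{b+1}, b̄}. Then the number of entries strictly between positions j and k satisfies k − j − 1 < s − b. -/
open Complex Filter Topology

open scoped Classical

noncomputable section

namespace CsBethe

/-- `Φ(u) = (q^u - q^{-u})/(q - q⁻¹)` (with the principal branch of `log`). -/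
def Phi (q u : ℂ) : ℂ := (q ^ u - q ^ (-u)) / (q - q⁻¹)

/-- `Q_a(u) = ∏_{j < N a} Φ(u - r a j)`.  With `N 0 = 0` and `N (s+1) = 0` this
gives `Q_0 = Q_{s+1} = 1`. -/
def Q (q : ℂ) (N : ℕ → ℕ) (r : ℕ → ℕ → ℂ) (a : ℕ) (u : ℂ) : ℂ :=
  ∏ j ∈ Finset.range (N a), Phi q (u - r a j)

/-- `q` is not a root of unity. -/
def NotRootOfUnity (q : ℂ) : Prop := ∀ n : ℕ, 0 < n → q ^ n ≠ 1

/-- Numerator of the box function, built from a `Q`-like family `QF`.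
Coding of the set `J = {1,…,s,s̄,…,1̄}`: the letter `j ∈ {1,…,s}` is coded by `j`,
and the barred letter `ā` (for `1 ≤ a ≤ s`) is coded by `2s+1-a`; so codes run
through `1,…,2s` in the total order `1 ≺ ⋯ ≺ s ≺ s̄ ≺ ⋯ ≺ 1̄`. -/
def boxNumG (s : ℕ) (QF : ℕ → ℂ → ℂ) (j : ℕ) (u : ℂ) : ℂ :=
  if j = 1 then QF 1 (u - 1/2)
  else if j < s then QF (j-1) (u - ((j:ℂ)-1)/2) * QF j (u - ((j:ℂ)-4)/2)
  else if j = s then QF (s-1) (u - ((s:ℂ)-1)/2) * QF s (u - ((s:ℂ)-5)/2)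
  else if j = s+1 then QF (s-1) (u - ((s:ℂ)-1)/2) * QF s (u - ((s:ℂ)+3)/2)
  else if j < 2*s then
    QF (2*s-j) (u - (2*(s:ℂ) - ((2*s+1-j : ℕ):ℂ) - 1)/2) *
      QF (2*s+1-j) (u - (2*(s:ℂ) - ((2*s+1-j : ℕ):ℂ) + 2)/2)
  else QF 1 (u - (2*(s:ℂ)-3)/2)

/-- Denominator of the box function. -/
def boxDenG (s : ℕ) (QF : ℕ → ℂ → ℂ) (j : ℕ) (u : ℂ) : ℂ :=
  if j = 1 then QF 1 (u + 1/2)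
  else if j < s then QF (j-1) (u - ((j:ℂ)-3)/2) * QF j (u - ((j:ℂ)-2)/2)
  else if j = s then QF (s-1) (u - ((s:ℂ)-3)/2) * QF s (u - ((s:ℂ)-1)/2)
  else if j = s+1 then QF (s-1) (u - ((s:ℂ)+1)/2) * QF s (u - ((s:ℂ)-1)/2)
  else if j < 2*s then
    QF (2*s-j) (u - (2*(s:ℂ) - ((2*s+1-j : ℕ):ℂ) + 1)/2) *
      QF (2*s+1-j) (u - (2*(s:ℂ) - ((2*s+1-j : ℕ):ℂ))/2)
  else QF 1 (u - (2*(s:ℂ)-1)/2)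

/-- The box function `[j]_u` (trivial vacuum). -/
def box (s : ℕ) (q : ℂ) (N : ℕ → ℕ) (r : ℕ → ℕ → ℂ) (j : ℕ) (u : ℂ) : ℂ :=
  boxNumG s (Q q N r) j u / boxDenG s (Q q N r) j u

/-- Denominator of the box function `[j]_u`. -/
def boxDen (s : ℕ) (q : ℂ) (N : ℕ → ℕ) (r : ℕ → ℕ → ℂ) (j : ℕ) (u : ℂ) : ℂ :=
  boxDenG s (Q q N r) j u

/-- Parity: `p(1) = p(1̄) = 0`, `p(b) = 1` otherwise. -/
def parity (s j : ℕ) : ℕ := if j = 1 ∨ j = 2*s then 0 else 1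

/-- Admissibility of a column `(i_1,…,i_a)` (the set `B(1^a)`), in the coding above:
entries weakly increase, strictly on the set `J_+ = {1,1̄}`, except that the
consecutive pair `(s̄,s)` is also admissible. -/
def colAdm (s : ℕ) {a : ℕ} (i : Fin a → ℕ) : Prop :=
  (∀ k, 1 ≤ i k ∧ i k ≤ 2*s) ∧
  ∀ (k : ℕ) (h : k + 1 < a),
    ((i ⟨k, by omega⟩ ≤ i ⟨k+1, h⟩ ∧
        (((i ⟨k, by omega⟩ = 1 ∨ i ⟨k, by omega⟩ = 2*s) ∧
          (i ⟨k+1, h⟩ = 1 ∨ i ⟨k+1, h⟩ = 2*s)) → i ⟨k, by omega⟩ < i ⟨k+1, h⟩))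
      ∨ (i ⟨k, by omega⟩ = s+1 ∧ i ⟨k+1, h⟩ = s))

/-- Admissibility of a row `(i_1,…,i_m)` (the set `B(m^1)`): entries weakly increase,
strictly on `J ∖ {1,1̄}`; moreover if `i_j = d` and `i_k = d̄` with `j < k` then
`s + j - k ≥ d` (stated additively). -/
def rowAdm (s : ℕ) {m : ℕ} (i : Fin m → ℕ) : Prop :=
  (∀ k, 1 ≤ i k ∧ i k ≤ 2*s) ∧
  (∀ (k : ℕ) (h : k + 1 < m),
      i ⟨k, by omega⟩ ≤ i ⟨k+1, h⟩ ∧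
        ((2 ≤ i ⟨k, by omega⟩ ∧ i ⟨k, by omega⟩ ≤ 2*s - 1 ∧
          2 ≤ i ⟨k+1, h⟩ ∧ i ⟨k+1, h⟩ ≤ 2*s - 1) → i ⟨k, by omega⟩ < i ⟨k+1, h⟩)) ∧
  (∀ j k : Fin m, (j:ℕ) < (k:ℕ) → ∀ d : ℕ, 1 ≤ d → d ≤ s →
      i j = d → i k = 2*s + 1 - d → (k:ℕ) + d ≤ s + (j:ℕ))

/-- The column dressed vacuum form `𝒯^a(u)`. -/
def Tcol (s : ℕ) (q : ℂ) (N : ℕ → ℕ) (r : ℕ → ℕ → ℂ) (a : ℕ) (u : ℂ) : ℂ :=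
  ∑ i : Fin a → Fin (2*s+1),
    if colAdm s (fun k => ((i k : ℕ))) then
      (-1 : ℂ) ^ (∑ k : Fin a, parity s ((i k : ℕ))) *
        ∏ j : Fin a, box s q N r ((i j : ℕ)) (u + ((a:ℂ) - 1 - 2*((j:ℕ):ℂ))/2)
    else 0

/-- The row dressed vacuum form `T_m^{(1)}(u)`. -/
def Trow (s : ℕ) (q : ℂ) (N : ℕ → ℕ) (r : ℕ → ℕ → ℂ) (m : ℕ) (u : ℂ) : ℂ :=
  ∑ i : Fin m → Fin (2*s+1),
    if rowAdm s (fun k => ((i k : ℕ))) then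
      (-1 : ℂ) ^ (∑ k : Fin m, parity s ((i k : ℕ))) *
        ∏ j : Fin m, box s q N r ((i j : ℕ)) (u + (2*((j:ℕ):ℂ) + 1 - (m:ℂ))/2)
    else 0

/-- `u` is a good point for `𝒯^a`: no `Q`-factor occurring in a denominator of a box
of `𝒯^a` vanishes there. -/
def colGood (s : ℕ) (q : ℂ) (N : ℕ → ℕ) (r : ℕ → ℕ → ℂ) (a : ℕ) (u : ℂ) : Prop :=
  ∀ j : ℕ, 1 ≤ j → j ≤ 2*s → ∀ p : Fin a,
    boxDen s q N r j (u + ((a:ℂ) - 1 - 2*((p:ℕ):ℂ))/2) ≠ 0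

/-- `u` is a good point for `T_m^{(1)}`: no `Q`-factor occurring in a denominator of a
box of `T_m^{(1)}` vanishes there. -/
def rowGood (s : ℕ) (q : ℂ) (N : ℕ → ℕ) (r : ℕ → ℕ → ℂ) (m : ℕ) (u : ℂ) : Prop :=
  ∀ j : ℕ, 1 ≤ j → j ≤ 2*s → ∀ p : Fin m,
    boxDen s q N r j (u + (2*((p:ℕ):ℂ) + 1 - (m:ℂ))/2) ≠ 0

/-- The Bethe ansatz equations for `C(s)` (distinguished simple roots, trivial vacuum). -/
def BAE (s : ℕ) (q : ℂ) (N : ℕ → ℕ) (r : ℕ → ℕ → ℂ) : Prop :=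
  (∀ k < N 1, Q q N r 2 (r 1 k + 1/2) = Q q N r 2 (r 1 k - 1/2)) ∧
  (∀ a, 2 ≤ a → a ≤ s - 2 → ∀ k < N a,
      (-1 : ℂ) =
        Q q N r (a-1) (r a k + 1/2) * Q q N r a (r a k - 1) * Q q N r (a+1) (r a k + 1/2) /
        (Q q N r (a-1) (r a k - 1/2) * Q q N r a (r a k + 1) * Q q N r (a+1) (r a k - 1/2))) ∧
  (∀ k < N (s-1),
      (-1 : ℂ) =
        Q q N r (s-2) (r (s-1) k + 1/2) * Q q N r (s-1) (r (s-1) k - 1) *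
            Q q N r s (r (s-1) k + 1) /
        (Q q N r (s-2) (r (s-1) k - 1/2) * Q q N r (s-1) (r (s-1) k + 1) *
            Q q N r s (r (s-1) k - 1))) ∧
  (∀ k < N s,
      (-1 : ℂ) =
        Q q N r (s-1) (r s k + 1) * Q q N r s (r s k - 2) /
        (Q q N r (s-1) (r s k - 1) * Q q N r s (r s k + 2)))

/-- Genericity of the Bethe roots: within each color the roots are pairwise distinct and,
more generally, no two (shifted) candidate pole locations coincide: differences of roots
of any two colors are never nonzero half-integers, and roots of different colors never
coincide.  In particular all BAE ratios are well defined. -/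
def Generic (s : ℕ) (N : ℕ → ℕ) (r : ℕ → ℕ → ℂ) : Prop :=
  ∀ a b, 1 ≤ a → a ≤ s → 1 ≤ b → b ≤ s → ∀ j < N a, ∀ k < N b, ∀ t : ℤ,
    r a j - r b k = (t : ℂ) / 2 → a = b ∧ j = k ∧ t = 0

/-- The residue of `f` at `v0` vanishes: `(v - v0) · f v → 0` as `v → v0`, `v ≠ v0`. -/
def ResidueZero (f : ℂ → ℂ) (v0 : ℂ) : Prop :=
  Filter.Tendsto (fun v => (v - v0) * f v) (𝓝[≠] v0) (𝓝 0)

/-- `f` has a removable singularity at `v0`: some function differentiable at `v0`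
agrees with `f` on a punctured neighbourhood of `v0`. -/
def RemovableAt (f : ℂ → ℂ) (v0 : ℂ) : Prop :=
  ∃ F : ℂ → ℂ, DifferentiableAt ℂ F v0 ∧ ∀ᶠ v in 𝓝[≠] v0, F v = f v

/-- The deformed dressed vacuum form
`𝒯_c(u) = Q_1(u - c/2) · T_{s-1}^{(1)}(u + (c-s+1)/2) / Q_1(u + c/2 - s + 1)`. -/
def Tdef (s : ℕ) (q : ℂ) (N : ℕ → ℕ) (r : ℕ → ℕ → ℂ) (c : ℂ) (u : ℂ) : ℂ :=
  Q q N r 1 (u - c/2) * Trow s q N r (s-1) (u + (c - (s:ℂ) + 1)/2) /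
    Q q N r 1 (u + c/2 - (s:ℂ) + 1)

/-- A strictly increasing word `f` on the positions `p, …, p + n - 1`, with letters in
`{s + 1 - t, …, s + t}`, has length at most `t` whenever each pair of letters `d`, `2s + 1 - d`
occurring in it has positions at distance at most `s - d`. -/
theorem length_le_of_strictMono_of_dist_le {s : ℕ} {f : ℕ → ℕ} {t : ℕ} (hts : t ≤ s) {p n : ℕ}
    (hmono : ∀ x y, p ≤ x → x < y → y < p + n → f x < f y)
    (hrange : ∀ x, p ≤ x → x < p + n → s + 1 - t ≤ f x ∧ f x ≤ s + t)
    (hdist : ∀ x y, p ≤ x → x < y → y < p + n → 1 ≤ f x → f x ≤ s →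
      f y = 2 * s + 1 - f x → y + f x ≤ s + x) :
    n ≤ t := by
  induction t generalizing p n with
  | zero =>
    by_contra! hn
    have := hrange p le_rfl (by omega)
    omega
  | succ t ih =>
    by_contra! hn
    have shrink : ∀ p' n', p ≤ p' → p' + n' ≤ p + n →
        (∀ x, p' ≤ x → x < p' + n' → f x ≠ s - t ∧ f x ≠ s + t + 1) → n' ≤ t := by
      intro p' n' hp hn hne
      refine ih (by omega) (p := p') (fun x y hx hxy hy => hmono x y (by omega) hxy (by omega)) ?_
        (fun x y hx hxy hy => hdist x y (by omega) hxy (by omega))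
      intro x hx hxn
      have := hrange x (by omega) (by omega)
      have := hne x hx hxn
      omega
    have hmin : ∀ x, p < x → x < p + n → f x ≠ s - t := fun x hx hxn => by
      have := hmono p x le_rfl hx hxn
      have := hrange p le_rfl (by omega)
      omega
    have hmax : ∀ x, p ≤ x → x + 1 < p + n → f x ≠ s + t + 1 := fun x hx hxn => by
      have := hmono x (p + n - 1) hx (by omega) (by omega)
      have := hrange (p + n - 1) (by omega) (by omega)
      omega
    by_cases hp : f p = s - t
    · by_cases hq : f (p + n - 1) = s + t + 1
      · have := hdist p (p + n - 1) le_rfl (by omega) (by omega) (by omega) (by omega) (by omega)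
        omega
      · have := shrink (p + 1) (n - 1) (by omega) (by omega) fun x hx hxn =>
          ⟨hmin x (by omega) (by omega), by
            obtain rfl | hne := eq_or_ne x (p + n - 1)
            · exact hq
            · exact hmax x (by omega) (by omega)⟩
        omega
    · have := shrink p (n - 1) le_rfl (by omega) fun x hx hxn =>
        ⟨by
          obtain rfl | hne := eq_or_ne x p
          · exact hp
          · exact hmin x (by omega) (by omega), hmax x hx (by omega)⟩
      omega

/-- The entries of an admissible row weakly increase. -/
theorem rowAdm.monotone {s m : ℕ} {i : Fin m → ℕ} (h : rowAdm s i) : Monotone i := by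
  have key : ∀ (x n : ℕ) (hx : x + n < m), i ⟨x, by omega⟩ ≤ i ⟨x + n, hx⟩ := by
    intro x n
    induction n with
    | zero => exact fun _ => le_rfl
    | succ n ih => exact fun hx => (ih (by omega)).trans (h.2.1 (x + n) hx).1
  intro x y hxy
  obtain ⟨n, hn⟩ := Nat.exists_eq_add_of_le (Fin.le_def.mp hxy)
  obtain ⟨y, hy⟩ := y
  obtain rfl : y = x + n := hn
  exact key x n hy

/-- Entries of an admissible row strictly increase on the letters other than `1` and `1̄`. -/
theorem rowAdm.lt_of_lt {s m : ℕ} {i : Fin m → ℕ} (h : rowAdm s i) {x y : Fin m} (hxy : x < y)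
    (hx : 2 ≤ i x) (hy : i y ≤ 2 * s - 1) : i x < i y := by
  have hlt : (x : ℕ) + 1 < m := by omega
  have hle : i ⟨x + 1, hlt⟩ ≤ i y := h.monotone (Fin.le_def.mpr hxy)
  have hstep : i x ≤ i ⟨x + 1, hlt⟩ ∧ _ := h.2.1 x hlt
  exact (hstep.2 ⟨hx, by simp only [Fin.eta]; omega, by omega, by omega⟩).trans_le hle

/-- if an admissible row contains the pair `(b, \overline{b+1})` or
`(b+1, b̄)` at positions `j < k`, and no other entry lies in
`{b, b+1, \overline{b+1}, b̄}`, then the number of entries strictly between the two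
positions is `< s - b`.  (Codes: `\overline{b+1} = 2s-b`, `b̄ = 2s+1-b`.) -/
theorem row_middle_length_lt
    (s : ℕ) (hs : 3 ≤ s) (b : ℕ) (hb2 : 2 ≤ b) (hbs : b ≤ s - 1)
    (m : ℕ) (hm1 : 1 ≤ m) (hms : m ≤ s - 1)
    (i : Fin m → ℕ) (hadm : rowAdm s i)
    (j k : Fin m) (hjk : (j:ℕ) < (k:ℕ))
    (hpair : (i j = b ∧ i k = 2*s - b) ∨ (i j = b + 1 ∧ i k = 2*s + 1 - b))
    (hother : ∀ l : Fin m, l ≠ j → l ≠ k →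
      i l ≠ b ∧ i l ≠ b + 1 ∧ i l ≠ 2*s - b ∧ i l ≠ 2*s + 1 - b) :
    (k:ℕ) - (j:ℕ) - 1 < s - b := by
  set f : ℕ → ℕ := fun x => if h : x < m then i ⟨x, h⟩ else 0 with hf
  have hfi : ∀ x (h : x < m), f x = i ⟨x, h⟩ := fun x h => by simp [hf, h]
  have hrange : ∀ x : Fin m, j < x → x < k → b + 2 ≤ i x ∧ i x ≤ 2 * s - 1 - b := by
    intro x hjx hxk
    have := hadm.monotone hjx.le
    have := hadm.monotone hxk.le
    have := hother x hjx.ne' hxk.ne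
    omega
  have hlen : (k : ℕ) - j - 1 ≤ s - b - 1 := by
    refine length_le_of_strictMono_of_dist_le (s := s) (f := f) (p := j + 1) (by omega) ?_ ?_ ?_
    · intro x y hx hxy hy
      rw [hfi x (by omega), hfi y (by omega)]
      have hlow := hrange ⟨x, by omega⟩ (Fin.lt_def.mpr hx) (Fin.lt_def.mpr (by grind))
      have hhigh := hrange ⟨y, by omega⟩ (Fin.lt_def.mpr (by grind)) (Fin.lt_def.mpr (by grind))
      exact hadm.lt_of_lt (Fin.lt_def.mpr hxy) (by omega) (by omega)
    · intro x hx hxn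
      rw [hfi x (by omega)]
      have := hrange ⟨x, by omega⟩ (Fin.lt_def.mpr hx) (Fin.lt_def.mpr (by grind))
      omega
    · intro x y hx hxy hy
      rw [hfi x (by omega), hfi y (by omega)]
      exact fun h1 h2 h3 => hadm.2.2 ⟨x, by omega⟩ ⟨y, by omega⟩ hxy _ h1 h2 rfl h3
  omega

end CsBethe
end
end

section
/- The factor Q_1(w − (s−1)/2) divides T_{s−1}^(1)(w): if w ∈ ℂ satisfies Q_1(w − (s−1)/2) = 0, and every Q-factor occurring in a denominator of a box of T_{s−1}^(1) at argument w is nonzero, then T_{s−1}^(1)(w) = 0. (Every term of T_{s−1}^(1)(w) contains Q_1(w − (s−1)/2) in its numerator, via the box [1] or [2] at the first position, or [1̄] or [2̄] at the last position.) -/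
open Complex Filter Topology

open scoped Classical

noncomputable section

namespace CsBethe

/-- Among `s - 1` strictly increasing letters of `{3,…,s,s̄,…,3̄}`, some conjugate pair `d, d̄`
sits at positions `j < k` with `k - j > s - d`. -/
lemma exists_conj_pair_far_apart (s : ℕ) (hs : 3 ≤ s) (g : ℕ → ℕ)
    (hmono : ∀ a b, a < b → b < s - 1 → g a < g b)
    (hrange : ∀ a < s - 1, 3 ≤ g a ∧ g a ≤ 2 * s - 2) :
    ∃ j k, j < k ∧ k < s - 1 ∧ g j + g k = 2 * s + 1 ∧ s + j < k + g j := by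
  by_contra! hfar
  let fold : ℕ → ℕ := fun a => min (g a) (2 * s + 1 - g a)
  have pair_of_fold_eq : ∀ x y, x < y → y < s - 1 → fold x = fold y →
      g x + g y = 2 * s + 1 ∧ g x = fold x := by
    intro x y hxy hy h
    have := hmono x y hxy hy
    have := hrange x (by omega)
    have := hrange y hy
    simp only [fold] at h ⊢
    omega
  have hex : ∃ d, ∃ j k, j < k ∧ k < s - 1 ∧ g j = d ∧ g j + g k = 2 * s + 1 := by
    obtain ⟨x, hx, y, hy, hne, h⟩ := Finset.exists_ne_map_eq_of_card_lt_of_maps_to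
      (s := Finset.range (s - 1)) (t := Finset.Icc 3 s) (f := fold)
      (by simp; omega) (by
        intro a ha
        have := hrange a (by simpa using ha)
        simp only [fold, Finset.coe_Icc, Set.mem_Icc]
        omega)
    simp only [Finset.mem_range] at hx hy
    rcases lt_or_gt_of_ne hne with hxy | hxy
    · exact ⟨_, x, y, hxy, hy, rfl, (pair_of_fold_eq x y hxy hy h).1⟩
    · exact ⟨_, y, x, hxy, hx, rfl, (pair_of_fold_eq y x hxy hx h.symm).1⟩
  obtain ⟨j, k, hjk, hk, hd, hsum⟩ := Nat.find_spec hex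
  have hmin : ∀ x y, x < y → y < s - 1 → g x + g y = 2 * s + 1 → g j ≤ g x := by
    intro x y hxy hy h
    rw [hd]
    exact Nat.find_min' hex ⟨x, y, hxy, hy, rfl, h⟩
  have hdist := hfar j k hjk hk hsum
  have hj3 := hrange j (by omega)
  have hcard : (Finset.range (s - 1) \ Finset.Icc j k).card = s - 1 - (k + 1 - j) := by
    rw [Finset.card_sdiff_of_subset (by intro x; simp; omega)]
    simp
  have hmaps : ∀ a ∈ Finset.range (s - 1) \ Finset.Icc j k, fold a ∈ Finset.Ico 3 (g j) := by
    intro a ha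
    simp only [Finset.mem_sdiff, Finset.mem_range, Finset.mem_Icc, not_and, not_le] at ha
    have := hrange a ha.1
    simp only [fold, Finset.mem_Ico]
    rcases lt_or_ge a j with h | h
    · have := hmono a j h (by omega)
      omega
    · have := hmono k a (ha.2 h) ha.1
      omega
  obtain ⟨x, hx, y, hy, hne, h⟩ := Finset.exists_ne_map_eq_of_card_lt_of_maps_to
    (by rw [hcard, Nat.card_Ico]; omega) hmaps
  have hlt := Finset.mem_Ico.mp (hmaps x hx)
  have hlt' := Finset.mem_Ico.mp (hmaps y hy)
  simp only [Finset.mem_sdiff, Finset.mem_range] at hx hy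
  rcases lt_or_gt_of_ne hne with hxy | hxy
  · obtain ⟨h1, h2⟩ := pair_of_fold_eq x y hxy hy.1 h
    have := hmin x y hxy hy.1 h1
    omega
  · obtain ⟨h1, h2⟩ := pair_of_fold_eq y x hxy hx.1 h.symm
    have := hmin y x hxy hx.1 h1
    omega

/-- An admissible row of length `s - 1` starts with `1` or `2`, or ends with `2̄` or `1̄`. -/
lemma rowAdm_first_le_or_le_last (s : ℕ) (hs : 3 ≤ s) (i : Fin (s - 1) → ℕ) (h : rowAdm s i) :
    i ⟨0, by omega⟩ ≤ 2 ∨ 2 * s - 1 ≤ i ⟨s - 2, by omega⟩ := by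
  by_contra! hc
  obtain ⟨hfirst, hlast⟩ := hc
  obtain ⟨-, hstep, hpair⟩ := h
  let g : ℕ → ℕ := fun n => if hn : n < s - 1 then i ⟨n, hn⟩ else 0
  have hg : ∀ n (hn : n < s - 1), g n = i ⟨n, hn⟩ := fun n hn => dif_pos hn
  have hle : ∀ a b, a ≤ b → b < s - 1 → g a ≤ g b := by
    intro a b hab
    induction b, hab using Nat.le_induction with
    | base => exact fun _ => le_rfl
    | succ b _ ih =>
      intro hb
      refine (ih (by omega)).trans ?_
      rw [hg b (by omega), hg (b + 1) hb]
      exact (hstep b hb).1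
  have hrange : ∀ a < s - 1, 3 ≤ g a ∧ g a ≤ 2 * s - 2 := by
    intro a ha
    have h0 := hle 0 a (by omega) ha
    have h1 := hle a (s - 2) (by omega) (by omega)
    rw [hg 0 (by omega)] at h0
    rw [hg (s - 2) (by omega)] at h1
    omega
  have hmono : ∀ a b, a < b → b < s - 1 → g a < g b := by
    intro a b hab hb
    refine lt_of_lt_of_le ?_ (hle (a + 1) b hab hb)
    have ha := hrange a (by omega)
    have ha' := hrange (a + 1) (by omega)
    rw [hg a (by omega)] at ha ⊢
    rw [hg (a + 1) (by omega)] at ha' ⊢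
    exact (hstep a (by omega)).2 ⟨by omega, by omega, by omega, by omega⟩
  obtain ⟨j, k, hjk, hk, hsum, hfar⟩ := exists_conj_pair_far_apart s hs g hmono hrange
  have hlt := hmono j k hjk hk
  have hj := hrange j (by omega)
  have := hpair ⟨j, by omega⟩ ⟨k, hk⟩ hjk (g j) (by omega) (by omega) (hg j (by omega)).symm
    (by rw [← hg k hk]; omega)
  simp only at this
  omega

lemma box_eq_zero_of_le_two (s : ℕ) (hs : 3 ≤ s) (q : ℂ) (N : ℕ → ℕ) (r : ℕ → ℕ → ℂ) (j : ℕ)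
    (hj : 1 ≤ j) (hj2 : j ≤ 2) (u : ℂ) (hQ : Q q N r 1 (u - 1 / 2) = 0) :
    box s q N r j u = 0 := by
  have hnum : boxNumG s (Q q N r) j u = 0 := by
    unfold boxNumG
    obtain rfl | rfl : j = 1 ∨ j = 2 := by omega
    · rwa [if_pos rfl]
    · have h2 : u - (((2 : ℕ) : ℂ) - 1) / 2 = u - 1 / 2 := by push_cast; ring
      rw [if_neg (by omega), if_pos (by omega), h2, hQ, zero_mul]
  rw [box, hnum, zero_div]

lemma box_eq_zero_of_le_last (s : ℕ) (hs : 3 ≤ s) (q : ℂ) (N : ℕ → ℕ) (r : ℕ → ℕ → ℂ) (j : ℕ)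
    (hj : 2 * s - 1 ≤ j) (u : ℂ)
    (hQ : Q q N r 1 (u - (2 * (s : ℂ) - 3) / 2) = 0) :
    box s q N r j u = 0 := by
  have hnum : boxNumG s (Q q N r) j u = 0 := by
    unfold boxNumG
    rw [if_neg (by omega), if_neg (by omega), if_neg (by omega), if_neg (by omega)]
    split_ifs with h
    · rw [show 2 * s - j = 1 by omega, show 2 * s + 1 - j = 2 by omega]
      have h2 : u - (2 * (s : ℂ) - ((2 : ℕ) : ℂ) - 1) / 2 = u - (2 * (s : ℂ) - 3) / 2 := by
        push_cast; ring
      rw [h2, hQ, zero_mul]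
    · exact hQ
  rw [box, hnum, zero_div]

/-- `Q_1(w - (s-1)/2)` divides `T_{s-1}^{(1)}(w)`: if it vanishes at `w`
while every `Q`-factor occurring in a denominator of a box of `T_{s-1}^{(1)}` at `w`
is nonzero, then `T_{s-1}^{(1)}(w) = 0`. -/
theorem Q1_divides_T
    (s : ℕ) (hs : 3 ≤ s) (q : ℂ) (hq0 : q ≠ 0) (hq : NotRootOfUnity q)
    (N : ℕ → ℕ) (r : ℕ → ℕ → ℂ) (hN0 : N 0 = 0) (hNs1 : N (s+1) = 0)
    (w : ℂ) (hQ : Q q N r 1 (w - ((s:ℂ) - 1)/2) = 0)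
    (hden : rowGood s q N r (s-1) w) :
    Trow s q N r (s-1) w = 0 := by
  unfold Trow
  refine Finset.sum_eq_zero fun i _ => ?_
  split_ifs with h
  swap
  · rfl
  refine mul_eq_zero_of_right _ ?_
  have hm : ((s - 1 : ℕ) : ℂ) = (s : ℂ) - 1 := by rw [Nat.cast_sub (by omega), Nat.cast_one]
  have hm' : ((s - 2 : ℕ) : ℂ) = (s : ℂ) - 2 := by rw [Nat.cast_sub (by omega), Nat.cast_two]
  rcases rowAdm_first_le_or_le_last s hs _ h with hi | hi
  · refine Finset.prod_eq_zero (Finset.mem_univ ⟨0, by omega⟩)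
      (box_eq_zero_of_le_two s hs q N r _ (h.1 _).1 hi _ ?_)
    rw [hm, ← hQ]
    congr 1
    push_cast
    ring
  · refine Finset.prod_eq_zero (Finset.mem_univ ⟨s - 2, by omega⟩)
      (box_eq_zero_of_le_last s hs q N r _ hi _ ?_)
    rw [hm, ← hQ]
    simp only [hm']
    congr 1
    ring

end CsBethe
end
end

section
/- As an identity of meromorphic functions of u (no Bethe ansatz equations required): T_1^(1)(u − 1/2)·T_1^(1)(u + 1/2) = T_2^(1)(u) + 𝒯^2(u), where T_1^(1), T_2^(1) are the row dressed-vacuum-forms of width 1 and 2 and 𝒯^2 is the column dressed-vacuum-form of height 2. -/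
open Complex Filter Topology

open scoped Classical

noncomputable section

namespace CsBethe

/-- A row of width one is admissible as soon as its entry is a letter. -/
theorem rowAdm_one_iff (s : ℕ) (i : Fin 1 → ℕ) : rowAdm s i ↔ 1 ≤ i 0 ∧ i 0 ≤ 2*s := by
  refine ⟨fun h => h.1 0, fun h => ⟨fun k => ?_, fun k hk => by omega, fun j k hjk => by omega⟩⟩
  rwa [Fin.fin_one_eq_zero k]

theorem rowAdm_two_iff (s : ℕ) (i : Fin 2 → ℕ) :
    rowAdm s i ↔ (1 ≤ i 0 ∧ i 0 ≤ 2*s) ∧ (1 ≤ i 1 ∧ i 1 ≤ 2*s) ∧ i 0 ≤ i 1 ∧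
      ((2 ≤ i 0 ∧ i 0 ≤ 2*s - 1 ∧ 2 ≤ i 1 ∧ i 1 ≤ 2*s - 1) → i 0 < i 1) ∧
      ¬ (i 0 = s ∧ i 1 = s + 1) := by
  constructor
  · rintro ⟨hr, hc, hd⟩
    have hc0 := hc 0 (by omega)
    have hd0 := hd 0 1 (by simp) s
    have hr0 := hr 0
    simp only [Fin.zero_eta, Fin.mk_one, zero_add, Fin.val_zero, Fin.val_one] at hc0 hd0
    exact ⟨hr0, hr 1, hc0.1, hc0.2, by omega⟩
  · rintro ⟨hr0, hr1, hle, hlt, hne⟩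
    refine ⟨Fin.forall_fin_two.2 ⟨hr0, hr1⟩, fun k hk => ?_, fun j k hjk d hd1 hds hj hk => ?_⟩
    · obtain rfl : k = 0 := by omega
      exact ⟨hle, hlt⟩
    · obtain rfl : j = 0 := by omega
      obtain rfl : k = 1 := by omega
      simp only [Fin.val_zero, Fin.val_one]
      omega

theorem colAdm_two_iff (s : ℕ) (i : Fin 2 → ℕ) :
    colAdm s i ↔ (1 ≤ i 0 ∧ i 0 ≤ 2*s) ∧ (1 ≤ i 1 ∧ i 1 ≤ 2*s) ∧
      ((i 0 ≤ i 1 ∧ (((i 0 = 1 ∨ i 0 = 2*s) ∧ (i 1 = 1 ∨ i 1 = 2*s)) → i 0 < i 1))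
        ∨ (i 0 = s + 1 ∧ i 1 = s)) := by
  constructor
  · rintro ⟨hr, hc⟩
    exact ⟨hr 0, hr 1, hc 0 (by omega)⟩
  · rintro ⟨hr0, hr1, h⟩
    refine ⟨Fin.forall_fin_two.2 ⟨hr0, hr1⟩, fun k hk => ?_⟩
    obtain rfl : k = 0 := by omega
    exact h

/-- A pair of letters is either an admissible row or, read backwards, an admissible column,
but not both. -/
theorem colAdm_swap_iff_not_rowAdm {s a b : ℕ} (hs : 2 ≤ s) (ha : 1 ≤ a ∧ a ≤ 2*s)
    (hb : 1 ≤ b ∧ b ≤ 2*s) : colAdm s ![b, a] ↔ ¬ rowAdm s ![a, b] := by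
  rw [colAdm_two_iff, rowAdm_two_iff]
  simp only [Matrix.cons_val_zero, Matrix.cons_val_one]
  omega

/-- The signed box function. -/
def signedBox (s : ℕ) (q : ℂ) (N : ℕ → ℕ) (r : ℕ → ℕ → ℂ) (j : ℕ) (u : ℂ) : ℂ :=
  (-1 : ℂ) ^ parity s j * box s q N r j u

theorem Trow_one (s : ℕ) (q : ℂ) (N : ℕ → ℕ) (r : ℕ → ℕ → ℂ) (u : ℂ) :
    Trow s q N r 1 u =
      ∑ a : Fin (2*s+1), if 1 ≤ (a : ℕ) ∧ (a : ℕ) ≤ 2*s then signedBox s q N r a u else 0 := by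
  rw [Trow, ← (Equiv.funUnique (Fin 1) (Fin (2*s+1))).symm.sum_comp]
  refine Finset.sum_congr rfl fun a _ => ?_
  simp [rowAdm_one_iff, signedBox]

theorem Trow_two (s : ℕ) (q : ℂ) (N : ℕ → ℕ) (r : ℕ → ℕ → ℂ) (u : ℂ) :
    Trow s q N r 2 u =
      ∑ a : Fin (2*s+1), ∑ b : Fin (2*s+1), if rowAdm s ![(a : ℕ), (b : ℕ)] then
        signedBox s q N r a (u - 1/2) * signedBox s q N r b (u + 1/2) else 0 := by
  rw [Trow, ← (finTwoArrowEquiv (Fin (2*s+1))).symm.sum_comp, Fintype.sum_prod_type]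
  refine Finset.sum_congr rfl fun a _ => Finset.sum_congr rfl fun b _ => ?_
  have hl : u + (2*((0 : ℕ) : ℂ) + 1 - ((2 : ℕ) : ℂ))/2 = u - 1/2 := by push_cast; ring
  have hr : u + (2*((1 : ℕ) : ℂ) + 1 - ((2 : ℕ) : ℂ))/2 = u + 1/2 := by push_cast; ring
  simp only [rowAdm_two_iff, finTwoArrowEquiv_symm_apply, Matrix.cons_val_zero,
    Matrix.cons_val_one, Fin.sum_univ_two, Fin.prod_univ_two, Fin.val_zero, Fin.val_one, hl, hr,
    signedBox, pow_add]
  congr 1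
  ring

theorem Tcol_two (s : ℕ) (q : ℂ) (N : ℕ → ℕ) (r : ℕ → ℕ → ℂ) (u : ℂ) :
    Tcol s q N r 2 u =
      ∑ a : Fin (2*s+1), ∑ b : Fin (2*s+1), if colAdm s ![(b : ℕ), (a : ℕ)] then
        signedBox s q N r a (u - 1/2) * signedBox s q N r b (u + 1/2) else 0 := by
  rw [Tcol, ← (finTwoArrowEquiv (Fin (2*s+1))).symm.sum_comp, Fintype.sum_prod_type_right]
  refine Finset.sum_congr rfl fun a _ => Finset.sum_congr rfl fun b _ => ?_
  have hl : u + (((2 : ℕ) : ℂ) - 1 - 2*((1 : ℕ) : ℂ))/2 = u - 1/2 := by push_cast; ring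
  have hr : u + (((2 : ℕ) : ℂ) - 1 - 2*((0 : ℕ) : ℂ))/2 = u + 1/2 := by push_cast; ring
  simp only [colAdm_two_iff, finTwoArrowEquiv_symm_apply, Matrix.cons_val_zero,
    Matrix.cons_val_one, Fin.sum_univ_two, Fin.prod_univ_two, Fin.val_zero, Fin.val_one, hl, hr,
    signedBox, pow_add]
  congr 1
  ring

/-- the functional relation
`T_1^{(1)}(u-1/2) T_1^{(1)}(u+1/2) = T_2^{(1)}(u) + 𝒯^2(u)` as an identity of
meromorphic functions (no BAE needed), i.e. at all points where no `Q`-factor in a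
denominator of any term vanishes. -/
theorem functional_relation_T1T1
    (s : ℕ) (hs : 3 ≤ s) (q : ℂ) (hq0 : q ≠ 0) (hq : NotRootOfUnity q)
    (N : ℕ → ℕ) (r : ℕ → ℕ → ℂ) (hN0 : N 0 = 0) (hNs1 : N (s+1) = 0)
    (u : ℂ)
    (h1 : rowGood s q N r 1 (u - 1/2)) (h2 : rowGood s q N r 1 (u + 1/2))
    (h3 : rowGood s q N r 2 u) (h4 : colGood s q N r 2 u) :
    Trow s q N r 1 (u - 1/2) * Trow s q N r 1 (u + 1/2) =
      Trow s q N r 2 u + Tcol s q N r 2 u := by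
  rw [Trow_one, Trow_one, Trow_two, Tcol_two, Finset.sum_mul_sum, ← Finset.sum_add_distrib]
  refine Finset.sum_congr rfl fun a _ => ?_
  rw [← Finset.sum_add_distrib]
  refine Finset.sum_congr rfl fun b _ => ?_
  by_cases ha : 1 ≤ (a : ℕ) ∧ (a : ℕ) ≤ 2*s
  · by_cases hb : 1 ≤ (b : ℕ) ∧ (b : ℕ) ≤ 2*s
    · by_cases hrow : rowAdm s ![(a : ℕ), (b : ℕ)] <;>
        simp [ha, hb, hrow, colAdm_swap_iff_not_rowAdm (by omega : 2 ≤ s) ha hb]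
    · have hrow : ¬ rowAdm s ![(a : ℕ), (b : ℕ)] := fun h => hb (h.1 1)
      have hcol : ¬ colAdm s ![(b : ℕ), (a : ℕ)] := fun h => hb (h.1 0)
      rw [if_neg hb, if_neg hrow, if_neg hcol, mul_zero, add_zero]
  · have hrow : ¬ rowAdm s ![(a : ℕ), (b : ℕ)] := fun h => ha (h.1 0)
    have hcol : ¬ colAdm s ![(b : ℕ), (a : ℕ)] := fun h => ha (h.1 1)
    rw [if_neg ha, if_neg hrow, if_neg hcol, zero_mul, add_zero]

end CsBethe
end
end

section
/- For every a ∈ {2,3,…,s} and any (j_1,…,j_{a−2}) ∈ B((a−2)^1), the row product of length 2s−a consisting of s+1−a boxes [1], then the boxes [j_1],…,[j_{a−2}], then s+1−a boxes [1̄], with the box at position p evaluated at u − (2s−a−1)/2 + (p−1), equals ∏_{k=1}^{a−2} [j_k]_{u+(2k−(a−2)−1)/2}; that is, every signed term of T_{a−2}^(1)(u) coincides with a term in the expansion of 𝒯_{a−2}(u). -/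
open Complex Filter Topology

open scoped Classical

noncomputable section

namespace CsBethe

/-- The boxes `[1]` and `[1̄]` are inverse to each other at spectral parameters a distance
`s - 1` apart. -/
lemma box_one_mul_box_two_mul (s : ℕ) (hs : 3 ≤ s) (q : ℂ) (N : ℕ → ℕ) (r : ℕ → ℕ → ℂ)
    (v w : ℂ) (hw : w = v + ((s : ℂ) - 1))
    (hadd : Q q N r 1 (v + 1/2) ≠ 0) (hsub : Q q N r 1 (v - 1/2) ≠ 0) :
    box s q N r 1 v * box s q N r (2*s) w = 1 := by
  have hnum : w - (2*(s:ℂ) - 3)/2 = v + 1/2 := by rw [hw]; ring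
  have hden : w - (2*(s:ℂ) - 1)/2 = v - 1/2 := by rw [hw]; ring
  have h_one : 2*s ≠ 1 := by omega
  have h_lt : ¬ 2*s < s := by omega
  have h_eq : 2*s ≠ s := by omega
  have h_succ : 2*s ≠ s + 1 := by omega
  simp only [box, boxNumG, boxDenG, if_true, h_one, h_lt, h_eq, h_succ, lt_irrefl, if_false,
    hnum, hden]
  rw [div_mul_div_comm, mul_comm, div_self (mul_ne_zero hadd hsub)]

/-- for `a ∈ {2,…,s}` and any admissible row `(j_1,…,j_{a-2})`, the row
of length `2s-a` consisting of `s+1-a` boxes `[1]`, the boxes `[j_1],…,[j_{a-2}]`, and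
`s+1-a` boxes `[1̄]`, with position `p` evaluated at `u - (2s-a-1)/2 + (p-1)`, equals
the corresponding term `∏_k [j_k]_{u+(2k-(a-2)-1)/2}` of `T_{a-2}^{(1)}(u)`. -/
theorem padded_term_coincidence
    (s : ℕ) (hs : 3 ≤ s) (q : ℂ) (hq0 : q ≠ 0) (hq : NotRootOfUnity q)
    (N : ℕ → ℕ) (r : ℕ → ℕ → ℂ) (hN0 : N 0 = 0) (hNs1 : N (s+1) = 0)
    (a : ℕ) (ha2 : 2 ≤ a) (has : a ≤ s)
    (j : Fin (a-2) → ℕ) (hadm : rowAdm s j) (u : ℂ)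
    (hQ : ∀ p : Fin (s+1-a),
      Q q N r 1 (u - (2*(s:ℂ) - (a:ℂ) - 1)/2 + ((p:ℕ):ℂ) + 1/2) ≠ 0 ∧
      Q q N r 1 (u - (2*(s:ℂ) - (a:ℂ) - 1)/2 + ((p:ℕ):ℂ) - 1/2) ≠ 0) :
    (∏ p : Fin (s+1-a),
        box s q N r 1 (u - (2*(s:ℂ) - (a:ℂ) - 1)/2 + ((p:ℕ):ℂ))) *
    (∏ kk : Fin (a-2),
        box s q N r (j kk) (u - (2*(s:ℂ) - (a:ℂ) - 1)/2 + (((s+1-a + (kk:ℕ) : ℕ)):ℂ))) *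
    (∏ p : Fin (s+1-a),
        box s q N r (2*s) (u - (2*(s:ℂ) - (a:ℂ) - 1)/2 + (((s-1 + (p:ℕ) : ℕ)):ℂ))) =
    ∏ kk : Fin (a-2),
        box s q N r (j kk) (u + (2*((kk:ℕ):ℂ) + 1 - ((a:ℂ) - 2))/2) := by
  rw [mul_right_comm, ← Finset.prod_mul_distrib, Finset.prod_eq_one, one_mul]
  · refine Finset.prod_congr rfl fun kk _ => ?_
    congr 1
    rw [Nat.cast_add, Nat.cast_sub (by omega)]
    push_cast
    ring
  · intro p _
    refine box_one_mul_box_two_mul s hs q N r _ _ ?_ (hQ p).1 (hQ p).2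
    rw [Nat.cast_add, Nat.cast_sub (by omega)]
    push_cast
    ring

end CsBethe
end
end

section
/- For every a ∈ {2,3,…,s}, the row product of length 2s−a consisting of s−a boxes [1], then the boxes [2],[3],…,[a], then s+1−a boxes [1̄], with the box at position p evaluated at u − (2s−a−1)/2 + (p−1), equals Q_a(u + 1/2)/Q_a(u − 1/2) when 2 ≤ a ≤ s−1, and equals Q_s(u + 1)/Q_s(u − 1) when a = s. Equivalently, with t_a = −2 for 2 ≤ a ≤ s−1 and t_s = −1, this product equals Q_a(u − 1/t_a)/Q_a(u + 1/t_a). -/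
open Complex Filter Topology

open scoped Classical

noncomputable section

namespace CsBethe

/-- The entry at (0-based) position `p` of the row `1,…,1,2,3,…,a,1̄,…,1̄` of length
`2s-a` (with `s-a` ones and `s+1-a` copies of `1̄ = 2s`). -/
def topEntry (s a p : ℕ) : ℕ :=
  if p < s - a then 1 else if p < s - 1 then p - (s - a) + 2 else 2*s

/-- Telescoping of a product of consecutive ratios in a field. -/
theorem prod_range_succ_div {K : Type*} [Field K] (F : ℕ → K) (n : ℕ)
    (h0 : F 0 ≠ 0) (hF : ∀ k < n, F k ≠ 0) :
    ∏ k ∈ Finset.range n, F (k + 1) / F k = F n / F 0 := by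
  induction n with
  | zero => simp [h0]
  | succ n ih =>
    rw [Finset.prod_range_succ, ih fun k hk => hF k (by omega)]
    have := hF n (by omega)
    field_simp

/-- Ratio of values of `Q_j` whose consecutive quotients are the boxes `[j]` of a row in which
the letter `j` is evaluated at `w + j - 2`. -/
def rowRatio (s : ℕ) (q : ℂ) (N : ℕ → ℕ) (r : ℕ → ℕ → ℂ) (w : ℂ) (j : ℕ) : ℂ :=
  if j < s then Q q N r j (w + (j:ℂ)/2) / Q q N r j (w + ((j:ℂ) - 2)/2)
  else Q q N r s (w + ((s:ℂ) + 1)/2) / Q q N r s (w + ((s:ℂ) - 3)/2)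

section Box

variable {s : ℕ} {q : ℂ} {N : ℕ → ℕ} {r : ℕ → ℕ → ℂ}

theorem boxDen_bar_one (hs : 1 < s) (x : ℂ) :
    boxDen s q N r (2*s) x = Q q N r 1 (x - (2*(s:ℂ)-1)/2) := by
  rw [boxDen, boxDenG, if_neg (by omega), if_neg (by omega), if_neg (by omega),
    if_neg (by omega), if_neg (by omega)]

theorem box_bar_one (hs : 1 < s) (x : ℂ) :
    box s q N r (2*s) x =
      Q q N r 1 (x - (2*(s:ℂ)-3)/2) / Q q N r 1 (x - (2*(s:ℂ)-1)/2) := by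
  rw [box, ← boxDen, boxDen_bar_one hs, boxNumG, if_neg (by omega), if_neg (by omega),
    if_neg (by omega), if_neg (by omega), if_neg (by omega)]

theorem boxDen_one (x : ℂ) : boxDen s q N r 1 x = Q q N r 1 (x + 1/2) := by
  simp [boxDen, boxDenG]

theorem box_one (x : ℂ) :
    box s q N r 1 x = Q q N r 1 (x - 1/2) / Q q N r 1 (x + 1/2) := by
  simp [box, boxNumG, boxDenG]

theorem boxDen_succ_of_lt {j : ℕ} (hj : 1 ≤ j) (hjs : j + 1 < s) (w : ℂ) :
    boxDen s q N r (j + 1) (w + (j:ℂ) - 1) =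
      Q q N r j (w + (j:ℂ)/2) * Q q N r (j+1) (w + ((j:ℂ) - 1)/2) := by
  rw [boxDen, boxDenG, if_neg (by omega), if_pos hjs]
  simp only [Nat.add_sub_cancel]
  push_cast
  ring_nf

theorem boxDen_succ_of_eq {j : ℕ} (hj : 1 ≤ j) (hjs : j + 1 = s) (w : ℂ) :
    boxDen s q N r (j + 1) (w + (j:ℂ) - 1) =
      Q q N r j (w + (j:ℂ)/2) * Q q N r (j+1) (w + ((j:ℂ) - 2)/2) := by
  subst hjs
  rw [boxDen, boxDenG, if_neg (by omega), if_neg (by omega), if_pos rfl]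
  simp only [Nat.add_sub_cancel]
  push_cast
  ring_nf

theorem box_succ {j : ℕ} (hj : 1 ≤ j) (hjs : j + 1 ≤ s) (w : ℂ) :
    box s q N r (j + 1) (w + (j:ℂ) - 1) =
      rowRatio s q N r w (j + 1) / rowRatio s q N r w j := by
  rw [box, ← boxDen, rowRatio, rowRatio, if_pos (show j < s by omega)]
  rcases hjs.lt_or_eq with h | h
  · rw [boxDen_succ_of_lt hj h, boxNumG, if_neg (by omega), if_pos h, if_pos h, div_div_div_eq]
    simp only [Nat.add_sub_cancel]
    push_cast
    ring_nf
  · rw [boxDen_succ_of_eq hj h]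
    subst h
    rw [boxNumG, if_neg (by omega), if_neg (by omega), if_pos rfl, if_neg (by omega), div_div_div_eq]
    simp only [Nat.add_sub_cancel]
    push_cast
    ring_nf

end Box

/-- The row product in terms of `rowRatio`, with `v` the argument of the first box. -/
theorem prod_box_topEntry {s : ℕ} (hs : 3 ≤ s) {q : ℂ} {N : ℕ → ℕ} {r : ℕ → ℕ → ℂ}
    {a : ℕ} (ha2 : 2 ≤ a) (has : a ≤ s) (v : ℂ)
    (hden : ∀ p < 2*s - a, boxDen s q N r (topEntry s a p) (v + (p:ℂ)) ≠ 0) :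
    ∏ p ∈ Finset.range (2*s - a), box s q N r (topEntry s a p) (v + (p:ℂ)) =
      rowRatio s q N r (v + (s:ℂ) - (a:ℂ)) a := by
  obtain ⟨n, rfl⟩ := Nat.exists_eq_add_of_le' has
  obtain ⟨m, rfl⟩ := Nat.exists_eq_add_of_le' ha2
  have hw : v + ((n + (m + 2) : ℕ) : ℂ) - ((m + 2 : ℕ) : ℂ) = v + n := by push_cast; ring
  rw [hw]
  set s := n + (m + 2) with hs_def
  set w : ℂ := v + n with hw_def
  have hsC : (s:ℂ) = n + m + 2 := by rw [hs_def]; push_cast; ring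
  have hone : ∀ p < n, topEntry s (m + 2) p = 1 := fun p hp => by
    rw [topEntry, if_pos (by omega)]
  have hmid : ∀ k < m + 1, topEntry s (m + 2) (n + k) = (k + 1) + 1 := fun k hk => by
    rw [topEntry, if_neg (by omega), if_pos (by omega)]; omega
  have hbar : ∀ k, topEntry s (m + 2) (n + (m + 1) + k) = 2 * s := fun k => by
    rw [topEntry, if_neg (by omega), if_neg (by omega)]
  have hmid_arg : ∀ k : ℕ, v + ((n + k : ℕ) : ℂ) = w + ((k + 1 : ℕ) : ℂ) - 1 := fun k => by
    rw [hw_def]; push_cast; ring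
  have hbar_den : ∀ k : ℕ,
      v + ((n + (m + 1) + k : ℕ) : ℂ) - (2*(s:ℂ) - 1)/2 = v + k - 1/2 := fun k => by
    rw [hsC]; push_cast; ring
  have hbar_num : ∀ k : ℕ,
      v + ((n + (m + 1) + k : ℕ) : ℂ) - (2*(s:ℂ) - 3)/2 = v + ((k + 1 : ℕ) : ℂ) - 1/2 :=
    fun k => by rw [hsC]; push_cast; ring
  have hdmid : ∀ k < m + 1, boxDen s q N r ((k + 1) + 1) (w + ((k + 1 : ℕ) : ℂ) - 1) ≠ 0 :=
    fun k hk => by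
      have h := hden (n + k) (by omega)
      rwa [hmid k hk, hmid_arg] at h
  -- the values of `Q_1` through which the boxes `[1]` and `[1̄]` telescope
  let F : ℕ → ℂ := fun k => Q q N r 1 (v + (k:ℂ) - 1/2)
  have hF : ∀ k < n + 1, F k ≠ 0 := fun k hk => by
    have h := hden (n + (m + 1) + k) (by omega)
    rwa [hbar, boxDen_bar_one (by omega), hbar_den] at h
  have hFn : F (n + 1) ≠ 0 ∧ F (n + 1) / F n = rowRatio s q N r w 1 := by
    have e : v + ((n + 1 : ℕ) : ℂ) - 1/2 = w + ((1:ℕ):ℂ)/2 := by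
      rw [hw_def]; push_cast; ring
    have e' : v + (n : ℂ) - 1/2 = w + (((1:ℕ):ℂ) - 2)/2 := by
      rw [hw_def]; push_cast; ring
    have h := hdmid 0 (by omega)
    simp only [zero_add] at h
    rw [boxDen_succ_of_lt le_rfl (by omega)] at h
    refine ⟨?_, ?_⟩
    · simp only [F, e]
      exact left_ne_zero_of_mul h
    · simp only [F, e, e']
      rw [rowRatio, if_pos (by omega)]
  have hG : ∀ k < m + 1, rowRatio s q N r w (k + 1) ≠ 0 := by
    intro k hk
    rcases Nat.eq_zero_or_pos k with rfl | hk0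
    · rw [zero_add, ← hFn.2]
      exact div_ne_zero hFn.1 (hF n (by omega))
    · obtain ⟨l, rfl⟩ := Nat.exists_eq_add_of_le' hk0
      have h1 := hdmid l (by omega)
      have h2 := hdmid (l + 1) hk
      rw [boxDen_succ_of_lt (by omega) (by omega)] at h1
      have hnum : Q q N r (l + 1 + 1) (w + ((l + 1 + 1 : ℕ) : ℂ)/2) ≠ 0 := by
        rcases Nat.lt_or_ge (l + 1 + 1 + 1) s with h | h
        · rw [boxDen_succ_of_lt (by omega) h] at h2
          exact left_ne_zero_of_mul h2
        · rw [boxDen_succ_of_eq (by omega) (by omega)] at h2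
          exact left_ne_zero_of_mul h2
      rw [rowRatio, if_pos (by omega)]
      refine div_ne_zero hnum ?_
      have e : w + (((l + 1 + 1 : ℕ) : ℂ) - 2)/2 = w + (((l + 1 : ℕ) : ℂ) - 1)/2 := by
        push_cast; ring
      rw [e]
      exact right_ne_zero_of_mul h1
  have hprod_one : ∏ p ∈ Finset.range n, box s q N r (topEntry s (m + 2) p) (v + (p:ℂ)) =
      F 0 / F n := by
    rw [← inv_div (F n), ← prod_range_succ_div F n (hF 0 (by omega)) fun k hk => hF k (by omega),
      ← Finset.prod_inv_distrib]
    refine Finset.prod_congr rfl fun p hp => ?_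
    rw [hone p (Finset.mem_range.mp hp), box_one, inv_div]
    have e : v + (p:ℂ) + 1/2 = v + ((p + 1 : ℕ) : ℂ) - 1/2 := by push_cast; ring
    rw [e]
  have hprod_mid : ∏ k ∈ Finset.range (m + 1),
      box s q N r (topEntry s (m + 2) (n + k)) (v + ((n + k : ℕ) : ℂ)) =
      rowRatio s q N r w (m + 2) / rowRatio s q N r w 1 := by
    rw [← prod_range_succ_div (fun k => rowRatio s q N r w (k + 1)) (m + 1) (hG 0 (by omega)) hG]
    refine Finset.prod_congr rfl fun k hk => ?_
    have hk := Finset.mem_range.mp hk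
    rw [hmid k hk, hmid_arg, box_succ (by omega) (by omega)]
  have hprod_bar : ∏ k ∈ Finset.range (n + 1),
      box s q N r (topEntry s (m + 2) (n + (m + 1) + k))
        (v + ((n + (m + 1) + k : ℕ) : ℂ)) = F (n + 1) / F 0 := by
    rw [← prod_range_succ_div F (n + 1) (hF 0 (by omega)) hF]
    refine Finset.prod_congr rfl fun k _ => ?_
    rw [hbar, box_bar_one (by omega), hbar_num, hbar_den]
  have hlen : 2 * s - (m + 2) = n + (m + 1) + (n + 1) := by omega
  rw [hlen, Finset.prod_range_add, Finset.prod_range_add, hprod_one, hprod_mid, hprod_bar,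
    ← hFn.2]
  have h0 := hF 0 (by omega)
  have hn := hF n (by omega)
  have hn1 := hFn.1
  field_simp

/-- the top-term identity: for `a ∈ {2,…,s}`, the above row product, with
position `p` evaluated at `u - (2s-a-1)/2 + (p-1)`, equals
`Q_a(u+1/2)/Q_a(u-1/2)` for `2 ≤ a ≤ s-1`, and `Q_s(u+1)/Q_s(u-1)` for `a = s`
(i.e. `Q_a(u - 1/t_a)/Q_a(u + 1/t_a)` with `t_a = -2`, `t_s = -1`). -/
theorem top_term_identity
    (s : ℕ) (hs : 3 ≤ s) (q : ℂ) (hq0 : q ≠ 0) (hq : NotRootOfUnity q)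
    (N : ℕ → ℕ) (r : ℕ → ℕ → ℂ) (hN0 : N 0 = 0) (hNs1 : N (s+1) = 0)
    (a : ℕ) (ha2 : 2 ≤ a) (has : a ≤ s) (u : ℂ)
    (hden : ∀ p : Fin (2*s - a),
      boxDen s q N r (topEntry s a (p:ℕ)) (u - (2*(s:ℂ) - (a:ℂ) - 1)/2 + ((p:ℕ):ℂ)) ≠ 0) :
    (a ≤ s - 1 →
      (∏ p : Fin (2*s - a),
        box s q N r (topEntry s a (p:ℕ)) (u - (2*(s:ℂ) - (a:ℂ) - 1)/2 + ((p:ℕ):ℂ))) =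
        Q q N r a (u + 1/2) / Q q N r a (u - 1/2)) ∧
    (a = s →
      (∏ p : Fin (2*s - a),
        box s q N r (topEntry s a (p:ℕ)) (u - (2*(s:ℂ) - (a:ℂ) - 1)/2 + ((p:ℕ):ℂ))) =
        Q q N r s (u + 1) / Q q N r s (u - 1)) := by
  have hden' : ∀ p < 2*s - a, boxDen s q N r (topEntry s a p)
      (u - (2*(s:ℂ) - (a:ℂ) - 1)/2 + (p:ℂ)) ≠ 0 := fun p hp => hden ⟨p, hp⟩
  have key := prod_box_topEntry hs ha2 has _ hden'
  rw [← Fin.prod_univ_eq_prod_range (fun p => box s q N r (topEntry s a p)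
    (u - (2*(s:ℂ) - (a:ℂ) - 1)/2 + (p:ℂ)))] at key
  rw [key]
  refine ⟨fun h => ?_, ?_⟩
  · rw [rowRatio, if_pos (by omega)]
    ring_nf
  · rintro rfl
    rw [rowRatio, if_neg (lt_irrefl _)]
    ring_nf

end CsBethe
end
end

section
/- Crossing symmetry of the dressed vacuum forms: since Φ(−u) = −Φ(u), define Q̃_a(u) = ∏_{j=1}^{N_a} Φ(u + u_j^(a)) (the Q-function with all Bethe roots negated) and let [·]~ denote the box functions built from the Q̃_a. Then for every b ∈ J one has [b]~_{−(u−s+1)} = [b̄]_u, where the bar map exchanges b ↔ b̄ (with double bar the identity). Consequently, the dressed vacuum forms satisfy 𝒯̃^a(−(u−s+1)) = 𝒯^a(u) for all a ∈ ℕ and T̃_m^(1)(−(u−s+1)) = T_m^(1)(u) for all 0 ≤ m ≤ s−1, where the tilde versions are built from the Q̃_a. -/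
open Complex Filter Topology

open scoped Classical

noncomputable section

namespace CsBethe

/-- `Φ` is odd. -/
lemma Phi_neg (q u : ℂ) : Phi q (-u) = -Phi q u := by
  unfold Phi
  rw [neg_neg]
  ring

/-- Negating the roots and the argument of `Q_a` only produces a sign. -/
lemma Q_neg_roots (q : ℂ) (N : ℕ → ℕ) (r : ℕ → ℕ → ℂ) (a : ℕ) {u v : ℂ} (h : u = -v) :
    Q q N (fun c j => -(r c j)) a u = (-1) ^ N a * Q q N r a v := by
  subst h
  have h : ∀ j, Phi q (-v - -(r a j)) = -1 * Phi q (v - r a j) := fun j => by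
    rw [neg_one_mul, ← Phi_neg]
    congr 1
    ring
  simp only [Q, h]
  rw [Finset.prod_mul_distrib, Finset.prod_const, Finset.card_range]

/-- Crossing symmetry of the box functions attached to unbarred letters. -/
lemma box_crossing_of_le (s : ℕ) (hs : 3 ≤ s) (q : ℂ) (N : ℕ → ℕ) (r : ℕ → ℕ → ℂ)
    (b : ℕ) (hb : 1 ≤ b) (hbs : b ≤ s) (u : ℂ) :
    box s q N (fun c j => -(r c j)) b (-(u - (s:ℂ) + 1)) = box s q N r (2*s + 1 - b) u := by
  have hsign : ∀ n : ℕ, (-1 : ℂ) ^ n ≠ 0 := fun n => pow_ne_zero n (by norm_num)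
  have cancel : ∀ (m n : ℕ) (w x y z : ℂ),
      ((-1) ^ m * w * ((-1) ^ n * x)) / ((-1) ^ m * y * ((-1) ^ n * z)) = w * x / (y * z) := by
    intro m n w x y z
    rw [mul_mul_mul_comm, mul_mul_mul_comm _ y,
      mul_div_mul_left _ _ (mul_ne_zero (hsign m) (hsign n))]
  unfold box boxNumG boxDenG
  rcases eq_or_lt_of_le hb with rfl | hb1
  · have h1 : ¬ (2*s + 1 - 1 = 1) := by omega
    have h2 : ¬ (2*s + 1 - 1 < s) := by omega
    have h3 : ¬ (2*s + 1 - 1 = s) := by omega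
    have h4 : ¬ (2*s + 1 - 1 = s + 1) := by omega
    have h5 : ¬ (2*s + 1 - 1 < 2*s) := by omega
    simp only [if_true, if_neg h1, if_neg h2, if_neg h3, if_neg h4, if_neg h5]
    rw [Q_neg_roots q N r 1 (v := u - (2*(s:ℂ)-3)/2) (by ring),
      Q_neg_roots q N r 1 (v := u - (2*(s:ℂ)-1)/2) (by ring), mul_div_mul_left _ _ (hsign _)]
  have hne : ¬ (b = 1) := by omega
  have h1 : ¬ (2*s + 1 - b = 1) := by omega
  have h2 : ¬ (2*s + 1 - b < s) := by omega
  have h3 : ¬ (2*s + 1 - b = s) := by omega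
  rcases eq_or_lt_of_le hbs with rfl | hlt
  · have h4 : 2*b + 1 - b = b + 1 := by omega
    simp only [if_neg hne, if_neg (lt_irrefl b), if_true, if_neg h1, if_neg h2, if_neg h3, if_pos h4]
    rw [Q_neg_roots q N r (b-1) (v := u - ((b:ℂ)-1)/2) (by ring),
      Q_neg_roots q N r b (v := u - ((b:ℂ)+3)/2) (by ring),
      Q_neg_roots q N r (b-1) (v := u - ((b:ℂ)+1)/2) (by ring),
      Q_neg_roots q N r b (v := u - ((b:ℂ)-1)/2) (by ring), cancel]
  · have h4 : ¬ (2*s + 1 - b = s + 1) := by omega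
    have h5 : 2*s + 1 - b < 2*s := by omega
    have h6 : 2*s - (2*s + 1 - b) = b - 1 := by omega
    have h7 : 2*s + 1 - (2*s + 1 - b) = b := by omega
    simp only [if_neg hne, if_pos hlt, if_neg h1, if_neg h2, if_neg h3, if_neg h4, if_pos h5, h6, h7]
    rw [Q_neg_roots q N r (b-1) (v := u - (2*(s:ℂ) - (b:ℂ) - 1)/2) (by ring),
      Q_neg_roots q N r b (v := u - (2*(s:ℂ) - (b:ℂ) + 2)/2) (by ring),
      Q_neg_roots q N r (b-1) (v := u - (2*(s:ℂ) - (b:ℂ) + 1)/2) (by ring),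
      Q_neg_roots q N r b (v := u - (2*(s:ℂ) - (b:ℂ))/2) (by ring), cancel]

/-- Crossing symmetry of the box functions. -/
lemma box_crossing (s : ℕ) (hs : 3 ≤ s) (q : ℂ) (N : ℕ → ℕ) (r : ℕ → ℕ → ℂ)
    (b : ℕ) (hb : 1 ≤ b) (hb' : b ≤ 2*s) (u : ℂ) :
    box s q N (fun c j => -(r c j)) b (-(u - (s:ℂ) + 1)) = box s q N r (2*s + 1 - b) u := by
  rcases le_or_gt b s with hbs | hbs
  · exact box_crossing_of_le s hs q N r b hb hbs u
  · have h := box_crossing_of_le s hs q N (fun c j => -(r c j)) (2*s + 1 - b) (by omega)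
      (by omega) (-(u - (s:ℂ) + 1))
    have hu : -(-(u - (s:ℂ) + 1) - (s:ℂ) + 1) = u := by ring
    have hbb : 2*s + 1 - (2*s + 1 - b) = b := by omega
    simp only [neg_neg, hu, hbb] at h
    exact h.symm

/-- The bar map on codes, fixing the unused code `0`. -/
def barFin (s : ℕ) (j : Fin (2*s+1)) : Fin (2*s+1) :=
  if h : (j : ℕ) = 0 then 0 else ⟨2*s + 1 - j, by omega⟩

lemma barFin_val {s : ℕ} {j : Fin (2*s+1)} (hj : 1 ≤ (j : ℕ)) :
    (barFin s j : ℕ) = 2*s + 1 - j := by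
  simp [barFin, show ¬ ((j : ℕ) = 0) by omega]

lemma barFin_eq_zero {s : ℕ} {j : Fin (2*s+1)} (hj : (j : ℕ) = 0) : (barFin s j : ℕ) = 0 := by
  simp [barFin, hj]

lemma barFin_involutive (s : ℕ) : Function.Involutive (barFin s) := by
  intro j
  apply Fin.ext
  by_cases hj : (j : ℕ) = 0
  · rw [barFin_eq_zero (barFin_eq_zero hj), hj]
  · have h1 := barFin_val (s := s) (j := j) (by omega)
    rw [barFin_val (by omega), h1]
    omega

/-- Reversing a tableau and barring its entries. -/
def reflectPerm (s a : ℕ) : Equiv.Perm (Fin a → Fin (2*s+1)) :=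
  Function.Involutive.toPerm (fun i k => barFin s (i k.rev)) fun i => by
    funext k
    simp [barFin_involutive s (i k)]

lemma parity_bar {s j : ℕ} (h : 1 ≤ j) (h' : j ≤ 2*s) : parity s (2*s + 1 - j) = parity s j := by
  unfold parity
  split_ifs <;> omega

/-- A signed sum over admissible tableaux is invariant under reversing and barring. -/
lemma sum_admissible_reflect (s a : ℕ) (adm : (Fin a → ℕ) → Prop)
    (hrange : ∀ i, adm i → ∀ k, 1 ≤ i k ∧ i k ≤ 2*s)
    (hrefl : ∀ i, adm i → adm (fun k => 2*s + 1 - i k.rev))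
    (f g : ℕ → Fin a → ℂ) (hfg : ∀ b, 1 ≤ b → b ≤ 2*s → ∀ j, f b j = g (2*s + 1 - b) j.rev) :
    (∑ i : Fin a → Fin (2*s+1), if adm (fun k => ((i k : ℕ))) then
      (-1 : ℂ) ^ (∑ k : Fin a, parity s ((i k : ℕ))) * ∏ j : Fin a, f (i j : ℕ) j else 0) =
    ∑ i : Fin a → Fin (2*s+1), if adm (fun k => ((i k : ℕ))) then
      (-1 : ℂ) ^ (∑ k : Fin a, parity s ((i k : ℕ))) * ∏ j : Fin a, g (i j : ℕ) j else 0 := by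
  have hval : ∀ i : Fin a → Fin (2*s+1), (∀ k, 1 ≤ (i k : ℕ)) →
      ∀ k, (reflectPerm s a i k : ℕ) = 2*s + 1 - (i k.rev : ℕ) :=
    fun i hi k => barFin_val (hi k.rev)
  have hto : ∀ i : Fin a → Fin (2*s+1), adm (fun k => ((i k : ℕ))) →
      adm (fun k => ((reflectPerm s a i k : ℕ))) := fun i hi => by
    simpa only [hval i fun k => (hrange _ hi k).1] using hrefl _ hi
  have hinv : ∀ i, reflectPerm s a (reflectPerm s a i) = i := fun i =>
    (reflectPerm s a).symm_apply_apply i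
  refine Fintype.sum_equiv (reflectPerm s a) _ _ fun i => ?_
  by_cases hi : adm (fun k => ((i k : ℕ)))
  · rw [if_pos hi, if_pos (hto i hi)]
    have hr := hrange _ hi
    simp only [hval i fun k => (hr k).1]
    congr 1
    · congr 1
      rw [← Equiv.sum_comp Fin.revPerm]
      refine Finset.sum_congr rfl fun k _ => ?_
      simpa using (parity_bar (hr k.rev).1 (hr k.rev).2).symm
    · rw [← Equiv.prod_comp Fin.revPerm]
      refine Finset.prod_congr rfl fun k _ => ?_
      simpa using hfg _ (hr k.rev).1 (hr k.rev).2 k.rev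
  · rw [if_neg hi, if_neg]
    intro h
    have h' := hto _ h
    rw [hinv] at h'
    exact hi h'

lemma rev_mk_eq {a k : ℕ} (h : k < a) : (⟨k, h⟩ : Fin a).rev = ⟨a - (k + 1), by omega⟩ := rfl

lemma colAdm_reflect {s a : ℕ} {i : Fin a → ℕ} (hi : colAdm s i) :
    colAdm s (fun k => 2*s + 1 - i k.rev) := by
  refine ⟨fun k => ?_, fun k h => ?_⟩
  · have := hi.1 k.rev
    dsimp only
    omega
  · have h2 := hi.2 (a - (k + 1 + 1)) (by omega)
    have hk : a - (k + 1 + 1) + 1 = a - (k + 1) := by omega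
    simp only [hk] at h2
    have hx := hi.1 ⟨a - (k + 1), by omega⟩
    have hy := hi.1 ⟨a - (k + 1 + 1), by omega⟩
    simp only [rev_mk_eq]
    omega

lemma rowAdm_reflect {s m : ℕ} {i : Fin m → ℕ} (hi : rowAdm s i) :
    rowAdm s (fun k => 2*s + 1 - i k.rev) := by
  refine ⟨fun k => ?_, fun k h => ?_, fun j k hjk d hd hds hj hk => ?_⟩
  · have := hi.1 k.rev
    dsimp only
    omega
  · have h2 := hi.2.1 (m - (k + 1 + 1)) (by omega)
    have hk : m - (k + 1 + 1) + 1 = m - (k + 1) := by omega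
    simp only [hk] at h2
    have hx := hi.1 ⟨m - (k + 1), by omega⟩
    have hy := hi.1 ⟨m - (k + 1 + 1), by omega⟩
    simp only [rev_mk_eq]
    omega
  · have hx := hi.1 j.rev
    have hy := hi.1 k.rev
    have hjr := Fin.val_rev j
    have hkr := Fin.val_rev k
    dsimp only at hj hk
    have := hi.2.2 k.rev j.rev (by omega) d hd hds (by omega) (by omega)
    omega

lemma cast_val_rev {a : ℕ} (j : Fin a) : ((j.rev : ℕ) : ℂ) = (a:ℂ) - ((j:ℕ):ℂ) - 1 := by
  rw [Fin.val_rev, Nat.cast_sub (by omega)]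
  push_cast
  ring

/-- crossing symmetry.  Since `Φ(-u) = -Φ(u)`, the box functions built
from the negated Bethe roots satisfy `[b]~_{-(u-s+1)} = [b̄]_u` (in the coding, the bar
map is `b ↦ 2s+1-b`), and consequently `𝒯̃^a(-(u-s+1)) = 𝒯^a(u)` and
`T̃_m^{(1)}(-(u-s+1)) = T_m^{(1)}(u)` for `0 ≤ m ≤ s-1`. -/
theorem crossing_symmetry
    (s : ℕ) (hs : 3 ≤ s) (q : ℂ) (hq0 : q ≠ 0) (hq : NotRootOfUnity q)
    (N : ℕ → ℕ) (r : ℕ → ℕ → ℂ) (hN0 : N 0 = 0) (hNs1 : N (s+1) = 0) :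
    (∀ b : ℕ, 1 ≤ b → b ≤ 2*s → ∀ u : ℂ,
      box s q N (fun c j => -(r c j)) b (-(u - (s:ℂ) + 1)) =
        box s q N r (2*s + 1 - b) u) ∧
    (∀ a : ℕ, ∀ u : ℂ,
      Tcol s q N (fun c j => -(r c j)) a (-(u - (s:ℂ) + 1)) = Tcol s q N r a u) ∧
    (∀ m : ℕ, m ≤ s - 1 → ∀ u : ℂ,
      Trow s q N (fun c j => -(r c j)) m (-(u - (s:ℂ) + 1)) = Trow s q N r m u) := by
  refine ⟨fun b hb hb' u => box_crossing s hs q N r b hb hb' u, fun a u => ?_, fun m _ u => ?_⟩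
  · refine sum_admissible_reflect s a (colAdm s) (fun _ hi => hi.1) (fun _ => colAdm_reflect)
      (fun b j => box s q N (fun c j => -(r c j)) b
        (-(u - (s:ℂ) + 1) + ((a:ℂ) - 1 - 2*((j:ℕ):ℂ))/2))
      (fun b j => box s q N r b (u + ((a:ℂ) - 1 - 2*((j:ℕ):ℂ))/2)) fun b hb hb' j => ?_
    rw [← box_crossing s hs q N r b hb hb', cast_val_rev]
    congr 1
    ring
  · refine sum_admissible_reflect s m (rowAdm s) (fun _ hi => hi.1) (fun _ => rowAdm_reflect)
      (fun b j => box s q N (fun c j => -(r c j)) b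
        (-(u - (s:ℂ) + 1) + (2*((j:ℕ):ℂ) + 1 - (m:ℂ))/2))
      (fun b j => box s q N r b (u + (2*((j:ℕ):ℂ) + 1 - (m:ℂ))/2)) fun b hb hb' j => ?_
    rw [← box_crossing s hs q N r b hb hb', cast_val_rev]
    congr 1
    ring

end CsBethe
end
end

section
/- For every integer m with 0 ≤ m ≤ s−1, the number of admissible rows of length m is #B(m^1) = Σ_{k=0}^{m} [ C(2s−2, k) − C(2s−2, k−2) ]·(m−k+1), where C(n, j) denotes the binomial coefficient, taken to be 0 when j < 0. -/
open Complex Filter Topology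

open scoped Classical

noncomputable section

namespace CsBethe

/-- The `2t` middle letters `s+1-t, …, s+t`, i.e. the codes of `s+1-t, …, s` and their bars. -/
def middle (s t : ℕ) : Finset ℕ := Finset.Icc (s + 1 - t) (s + t)

/-- `S` contains at most `t` of the `2t` middle letters, for every `t ≤ n`. -/
def MiddleBounded (s n : ℕ) (S : Finset ℕ) : Prop :=
  ∀ t ≤ n, (S ∩ middle s t).card ≤ t

/-- The row `1 … 1, S, 1̄ … 1̄` of length `m` beginning with `a` letters `1`. -/
def rowOf (s m : ℕ) (S : Finset ℕ) (a : ℕ) : Fin m → ℕ := fun p =>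
  if (p : ℕ) < a then 1
  else if h : (p : ℕ) - a < S.card then S.orderEmbOfFin rfl ⟨p - a, h⟩ else 2 * s

lemma middle_succ {s n : ℕ} (h : n + 1 ≤ s) :
    middle s (n + 1) = insert (s - n) (insert (s + n + 1) (middle s n)) := by
  ext x; simp only [middle, Finset.mem_Icc, Finset.mem_insert]; omega

lemma middle_mono {s t n : ℕ} (h : t ≤ n) : middle s t ⊆ middle s n :=
  Finset.Icc_subset_Icc (by omega) (by omega)

lemma middleBounded_succ {s n : ℕ} {S : Finset ℕ} (h : S ⊆ middle s (n + 1)) :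
    MiddleBounded s (n + 1) S ↔ MiddleBounded s n S ∧ S.card ≤ n + 1 := by
  constructor
  · intro H
    refine ⟨fun t ht => H t (by omega), ?_⟩
    have := H (n + 1) le_rfl
    rwa [Finset.inter_eq_left.2 h] at this
  · rintro ⟨H, hc⟩ t ht
    rcases Nat.lt_or_ge n t with h1 | h1
    · obtain rfl : t = n + 1 := by omega
      rwa [Finset.inter_eq_left.2 h]
    · exact H t h1

lemma middleBounded_insert {s n x : ℕ} {S : Finset ℕ} (hx : x ∉ middle s n) :
    MiddleBounded s n (insert x S) ↔ MiddleBounded s n S := by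
  refine forall₂_congr fun t ht => ?_
  rw [Finset.insert_inter_of_notMem (fun h => hx (middle_mono ht h))]

/-- It suffices to bound the middle parts delimited by a letter of `S` whose bar is in `S`. -/
lemma middleBounded_of_pairs {s n : ℕ} {S : Finset ℕ} (hn : n ≤ s)
    (h : ∀ t, 1 ≤ t → t ≤ n → s + 1 - t ∈ S → s + t ∈ S → (S ∩ middle s t).card ≤ t) :
    MiddleBounded s n S := by
  intro t
  induction t with
  | zero => intro _; simp [middle]
  | succ t ih =>
    intro ht
    have ih := ih (by omega)
    by_cases hb : s + 1 - (t + 1) ∈ S ∧ s + (t + 1) ∈ S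
    · exact h _ (by omega) ht hb.1 hb.2
    · rw [middle_succ (by omega)]
      rw [show s + 1 - (t + 1) = s - t by omega, show s + (t + 1) = s + t + 1 by omega] at hb
      by_cases h1 : s - t ∈ S
      · have h2 : s + t + 1 ∉ S := fun h2 => hb ⟨h1, h2⟩
        rw [Finset.inter_insert_of_mem h1, Finset.inter_insert_of_notMem h2]
        exact (Finset.card_insert_le _ _).trans (by omega)
      · rw [Finset.inter_insert_of_notMem h1]
        by_cases h2 : s + t + 1 ∈ S
        · rw [Finset.inter_insert_of_mem h2]
          exact (Finset.card_insert_le _ _).trans (by omega)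
        · rw [Finset.inter_insert_of_notMem h2]
          omega

/-- `C(n,k) - C(n,k-2)`, where `C(n,j) = 0` for `j < 0`. -/
def chooseDiff (n k : ℕ) : ℤ :=
  (n.choose k : ℤ) - (if 2 ≤ k then (n.choose (k - 2) : ℤ) else 0)

lemma chooseDiff_rec (n k : ℕ) :
    chooseDiff (n + 2) k = chooseDiff n k + (if 1 ≤ k then 2 * chooseDiff n (k - 1) else 0) +
      (if 2 ≤ k then chooseDiff n (k - 2) else 0) := by
  match k with
  | 0 => simp [chooseDiff]
  | 1 => simp [chooseDiff]
  | 2 => simp [chooseDiff, Nat.choose_succ_succ]; ring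
  | 3 => simp [chooseDiff, Nat.choose_succ_succ]; ring
  | k + 4 => simp [chooseDiff, Nat.choose_succ_succ]; ring

lemma chooseDiff_two_mul_succ (n : ℕ) : chooseDiff (2 * n) (n + 1) = 0 := by
  rcases n with _ | n
  · simp [chooseDiff]
  · have := Nat.choose_symm_of_eq_add (show 2 * (n + 1) = (n + 2) + n by ring)
    simp [chooseDiff, this]

/-- The number of subsets of size `k` of `2n` paired letters satisfying all middle bounds. -/
lemma card_middleBounded {s n : ℕ} (hn : n ≤ s) (k : ℕ) :
    (((middle s n).powerset.filter (fun S => MiddleBounded s n S ∧ S.card = k)).card : ℤ) =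
      if k ≤ n then chooseDiff (2 * n) k else 0 := by
  induction n generalizing k with
  | zero =>
    rcases k with _ | k
    · simp [middle, MiddleBounded, chooseDiff, Finset.filter_singleton]
    · simp [middle, Finset.filter_singleton]
  | succ n ih =>
    have ih := ih (by omega)
    simp only [Finset.card_filter, Nat.cast_sum, Nat.cast_ite, Nat.cast_one, Nat.cast_zero] at ih ⊢
    by_cases hk : k ≤ n + 1
    swap
    · rw [if_neg hk]
      refine Finset.sum_eq_zero fun S hS => if_neg ?_
      rw [middleBounded_succ (Finset.mem_powerset.1 hS)]
      omega
    have hx : s - n ∉ middle s n := by simp [middle]; omega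
    have hy : s + n + 1 ∉ middle s n := by simp [middle]
    have hxy : s - n ∉ insert (s + n + 1) (middle s n) := by
      rw [Finset.mem_insert]; push Not; exact ⟨by omega, hx⟩
    have hsub : ∀ S ∈ (middle s n).powerset, S ⊆ middle s (n + 1) := fun S hS =>
      (Finset.mem_powerset.1 hS).trans (middle_mono (by omega))
    have hxm : s - n ∈ middle s (n + 1) := by rw [middle_succ hn]; simp
    have hym : s + n + 1 ∈ middle s (n + 1) := by rw [middle_succ hn]; simp
    rw [if_pos hk]
    conv_lhs => rw [middle_succ hn]
    rw [Finset.sum_powerset_insert hxy, Finset.sum_powerset_insert hy,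
      Finset.sum_powerset_insert hy]
    have e0 : ∑ S ∈ (middle s n).powerset,
        (if MiddleBounded s (n + 1) S ∧ S.card = k then (1 : ℤ) else 0) =
          chooseDiff (2 * n) k := by
      have : chooseDiff (2 * n) k = if k ≤ n then chooseDiff (2 * n) k else 0 := by
        split_ifs with h
        · rfl
        · obtain rfl : k = n + 1 := by omega
          exact chooseDiff_two_mul_succ n
      rw [this, ← ih k]
      refine Finset.sum_congr rfl fun S hS => if_congr ?_ rfl rfl
      rw [middleBounded_succ (hsub S hS), and_assoc]
      exact and_congr_right fun _ => by omega
    have e1 : ∀ z, z ∉ middle s n → z ∈ middle s (n + 1) → ∑ S ∈ (middle s n).powerset,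
        (if MiddleBounded s (n + 1) (insert z S) ∧ (insert z S).card = k then (1 : ℤ) else 0) =
          if 1 ≤ k then chooseDiff (2 * n) (k - 1) else 0 := by
      intro z hz hzm
      have hk1 : (if 1 ≤ k then chooseDiff (2 * n) (k - 1) else 0) = ∑ S ∈ (middle s n).powerset,
          if 1 ≤ k then (if MiddleBounded s n S ∧ S.card = k - 1 then (1 : ℤ) else 0) else 0 := by
        split_ifs
        · rw [ih, if_pos (by omega)]
        · simp
      rw [hk1]
      refine Finset.sum_congr rfl fun S hS => ?_
      have hzS : z ∉ S := fun h => hz (Finset.mem_powerset.1 hS h)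
      rw [middleBounded_succ (Finset.insert_subset hzm (hsub S hS)), middleBounded_insert hz,
        Finset.card_insert_of_notMem hzS]
      by_cases hB : MiddleBounded s n S <;> simp only [hB, true_and, false_and, if_false, ite_self]
      split_ifs <;> first | rfl | omega
    have e2 : ∑ S ∈ (middle s n).powerset,
        (if MiddleBounded s (n + 1) (insert (s - n) (insert (s + n + 1) S)) ∧
          (insert (s - n) (insert (s + n + 1) S)).card = k then (1 : ℤ) else 0) =
          if 2 ≤ k then chooseDiff (2 * n) (k - 2) else 0 := by
      have hk2 : (if 2 ≤ k then chooseDiff (2 * n) (k - 2) else 0) = ∑ S ∈ (middle s n).powerset,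
          if 2 ≤ k then (if MiddleBounded s n S ∧ S.card = k - 2 then (1 : ℤ) else 0) else 0 := by
        split_ifs
        · rw [ih, if_pos (by omega)]
        · simp
      rw [hk2]
      refine Finset.sum_congr rfl fun S hS => ?_
      have hyS : s + n + 1 ∉ S := fun h => hy (Finset.mem_powerset.1 hS h)
      have hxS : s - n ∉ insert (s + n + 1) S := fun h =>
        hxy (Finset.insert_subset_insert _ (Finset.mem_powerset.1 hS) h)
      rw [middleBounded_succ (Finset.insert_subset hxm (Finset.insert_subset hym (hsub S hS))),
        middleBounded_insert hx, middleBounded_insert hy,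
        Finset.card_insert_of_notMem hxS, Finset.card_insert_of_notMem hyS]
      by_cases hB : MiddleBounded s n S <;> simp only [hB, true_and, false_and, if_false, ite_self]
      split_ifs <;> first | rfl | omega
    rw [e0, e1 _ hy hym, e1 _ hx hxm, e2, show 2 * (n + 1) = 2 * n + 2 by ring, chooseDiff_rec]
    split_ifs <;> ring

lemma rowOf_of_lt {s m : ℕ} {S : Finset ℕ} {a : ℕ} {p : Fin m} (h : (p : ℕ) < a) :
    rowOf s m S a p = 1 := if_pos h

lemma rowOf_of_middle {s m : ℕ} {S : Finset ℕ} {a : ℕ} {p : Fin m} (h : a ≤ (p : ℕ))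
    (h' : (p : ℕ) - a < S.card) :
    rowOf s m S a p = S.orderEmbOfFin rfl ⟨p - a, h'⟩ := by
  rw [rowOf, if_neg (by omega), dif_pos h']

lemma rowOf_of_ge {s m : ℕ} {S : Finset ℕ} {a : ℕ} {p : Fin m} (h : a + S.card ≤ (p : ℕ)) :
    rowOf s m S a p = 2 * s := by
  rw [rowOf, if_neg (by omega), dif_neg (by omega)]

/-- The number of elements of `S` between its elements of ranks `t ≤ u`. -/
lemma card_inter_Icc_orderEmbOfFin (S : Finset ℕ) (t u : Fin S.card) :
    (S ∩ Finset.Icc (S.orderEmbOfFin rfl t) (S.orderEmbOfFin rfl u)).card = u + 1 - t := by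
  rw [← Fin.card_Icc, ← Finset.card_map (S.orderEmbOfFin rfl).toEmbedding]
  congr 1
  ext x
  simp only [Finset.mem_inter, Finset.mem_Icc, Finset.mem_map]
  constructor
  · rintro ⟨hx, h1, h2⟩
    rw [← Finset.mem_coe, ← Finset.range_orderEmbOfFin S rfl] at hx
    obtain ⟨v, rfl⟩ := hx
    exact ⟨v, ⟨by simpa using h1, by simpa using h2⟩, rfl⟩
  · rintro ⟨v, ⟨h1, h2⟩, rfl⟩
    exact ⟨Finset.orderEmbOfFin_mem _ _ _, by simpa using h1, by simpa using h2⟩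

lemma rowAdm_rowOf {s m : ℕ} (hs : 3 ≤ s) (hm : m ≤ s - 1) {S : Finset ℕ}
    (hS : S ⊆ middle s (s - 1)) (hB : MiddleBounded s (s - 1) S) (a : ℕ) :
    rowAdm s (rowOf s m S a) := by
  have hmem : ∀ t, 2 ≤ S.orderEmbOfFin rfl t ∧ S.orderEmbOfFin rfl t ≤ 2 * s - 1 := by
    intro t
    have := hS (Finset.orderEmbOfFin_mem S rfl t)
    simp only [middle, Finset.mem_Icc] at this
    omega
  have hcases : ∀ p : Fin m, ((p : ℕ) < a ∧ rowOf s m S a p = 1) ∨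
      (∃ t : Fin S.card, (p : ℕ) = a + t ∧ rowOf s m S a p = S.orderEmbOfFin rfl t) ∨
      (a + S.card ≤ (p : ℕ) ∧ rowOf s m S a p = 2 * s) := by
    intro p
    by_cases h1 : (p : ℕ) < a
    · exact Or.inl ⟨h1, rowOf_of_lt h1⟩
    by_cases h2 : (p : ℕ) - a < S.card
    · exact Or.inr (Or.inl ⟨⟨p - a, h2⟩, by simp; omega, rowOf_of_middle (by omega) h2⟩)
    · exact Or.inr (Or.inr ⟨by omega, rowOf_of_ge (by omega)⟩)
  refine ⟨fun p => ?_, fun k h => ?_, fun j k hjk d hd hds hj hk => ?_⟩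
  · rcases hcases p with ⟨_, h⟩ | ⟨t, _, h⟩ | ⟨_, h⟩
    · omega
    · have := hmem t; omega
    · omega
  · rcases hcases ⟨k, by omega⟩ with ⟨h0, h1⟩ | ⟨t, h0, h1⟩ | ⟨h0, h1⟩ <;>
    rcases hcases ⟨k + 1, h⟩ with ⟨h2, h3⟩ | ⟨u, h2, h3⟩ | ⟨h2, h3⟩ <;>
    rw [h1, h3] <;> simp only at h0 h2
    · omega
    · have := hmem u; omega
    · omega
    · omega
    · have : S.orderEmbOfFin rfl t < S.orderEmbOfFin rfl u := by
        rw [OrderEmbedding.lt_iff_lt, Fin.lt_def]; omega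
      omega
    · have := hmem t; omega
    · omega
    · have := u.2; omega
    · omega
  · by_cases hd1 : d = 1
    · omega
    rcases hcases j with ⟨h0, h1⟩ | ⟨t, h0, h1⟩ | ⟨h0, h1⟩
    · omega
    · rcases hcases k with ⟨h2, h3⟩ | ⟨u, h2, h3⟩ | ⟨h2, h3⟩
      · omega
      · have := hB (s + 1 - d) (by omega)
        rw [middle, show s + 1 - (s + 1 - d) = S.orderEmbOfFin rfl t by omega,
          show s + (s + 1 - d) = S.orderEmbOfFin rfl u by omega,
          card_inter_Icc_orderEmbOfFin] at this
        omega
      · omega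
    · omega

lemma mem_iff_rowOf {s m : ℕ} (hs : 1 ≤ s) {S : Finset ℕ} (hS : S ⊆ middle s (s - 1)) {a : ℕ}
    (ha : a + S.card ≤ m) (x : ℕ) :
    x ∈ S ↔ x ∈ middle s (s - 1) ∧ ∃ p, rowOf s m S a p = x := by
  constructor
  · intro hx
    refine ⟨hS hx, ?_⟩
    rw [← Finset.mem_coe, ← Finset.range_orderEmbOfFin S rfl] at hx
    obtain ⟨t, rfl⟩ := hx
    refine ⟨⟨a + t, by omega⟩, ?_⟩
    rw [rowOf_of_middle (by simp) (by simp)]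
    congr 1
    simp
  · rintro ⟨hx, p, rfl⟩
    simp only [middle, Finset.mem_Icc] at hx
    by_cases h1 : (p : ℕ) < a
    · rw [rowOf_of_lt h1] at hx; omega
    by_cases h2 : (p : ℕ) - a < S.card
    · rw [rowOf_of_middle (by omega) h2]; exact Finset.orderEmbOfFin_mem _ _ _
    · rw [rowOf_of_ge (by omega)] at hx; omega

lemma rowOf_eq_one_iff {s m : ℕ} (hs : 1 ≤ s) {S : Finset ℕ} (hS : S ⊆ middle s (s - 1)) {a : ℕ}
    (p : Fin m) : rowOf s m S a p = 1 ↔ (p : ℕ) < a := by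
  refine ⟨fun h => ?_, rowOf_of_lt⟩
  by_contra h1
  by_cases h2 : (p : ℕ) - a < S.card
  · rw [rowOf_of_middle (by omega) h2] at h
    have := hS (Finset.orderEmbOfFin_mem S rfl ⟨_, h2⟩)
    simp only [middle, Finset.mem_Icc] at this
    omega
  · rw [rowOf_of_ge (by omega)] at h; omega

lemma rowOf_injective {s m : ℕ} (hs : 1 ≤ s) {S T : Finset ℕ} (hS : S ⊆ middle s (s - 1))
    (hT : T ⊆ middle s (s - 1)) {a b : ℕ} (ha : a + S.card ≤ m) (hb : b + T.card ≤ m)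
    (h : rowOf s m S a = rowOf s m T b) : S = T ∧ a = b := by
  constructor
  · ext x
    rw [mem_iff_rowOf hs hS ha, mem_iff_rowOf hs hT hb, h]
  · have key : ∀ p : Fin m, (p : ℕ) < a ↔ (p : ℕ) < b := fun p => by
      rw [← rowOf_eq_one_iff hs hS, h, rowOf_eq_one_iff hs hT]
    rcases lt_trichotomy a b with h1 | h1 | h1
    · have := (key ⟨a, by omega⟩).2 h1
      simp at this
    · exact h1
    · have := (key ⟨b, by omega⟩).1 h1
      simp at this

/-- A monotone tuple stays at most `x` exactly on an initial segment. -/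
lemma exists_le_iff_lt {m : ℕ} {i : Fin m → ℕ} (hi : Monotone i) (x : ℕ) :
    ∃ a ≤ m, ∀ p : Fin m, i p ≤ x ↔ (p : ℕ) < a := by
  by_cases h : ∃ n, ∃ hn : n < m, x < i ⟨n, hn⟩
  · refine ⟨Nat.find h, (Nat.find_spec h).1.le, fun p => ?_⟩
    obtain ⟨h1, h2⟩ := Nat.find_spec h
    constructor
    · intro hp
      by_contra hlt
      have := hi (show (⟨Nat.find h, h1⟩ : Fin m) ≤ p from Nat.not_lt.1 hlt)
      omega
    · intro hp
      by_contra hlt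
      exact Nat.find_min h hp ⟨p.2, by simpa using hlt⟩
  · push Not at h
    exact ⟨m, le_rfl, fun p => ⟨fun _ => p.2, fun _ => h p p.2⟩⟩

lemma exists_rowOf_eq {s m : ℕ} (hs : 3 ≤ s) {i : Fin m → ℕ} (hi : rowAdm s i) :
    ∃ S ⊆ middle s (s - 1), MiddleBounded s (s - 1) S ∧
      ∃ a, a + S.card ≤ m ∧ rowOf s m S a = i := by
  obtain ⟨hr, hstep, hpair⟩ := hi
  have hmono : Monotone i := by
    rcases m with _ | m
    · exact fun p => p.elim0
    · exact Fin.monotone_iff_le_succ.2 fun k => (hstep k (by omega)).1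
  obtain ⟨a, ham, ha⟩ := exists_le_iff_lt hmono 1
  obtain ⟨c, hcm, hc⟩ := exists_le_iff_lt hmono (2 * s - 1)
  have hac : a ≤ c := by
    by_contra h
    have h1 := (ha ⟨c, by omega⟩).2 (by simp; omega)
    have h2 := (hc ⟨c, by omega⟩).1 (by omega)
    simp at h2
  let e : Fin (c - a) → ℕ := fun t => i ⟨a + t, by omega⟩
  have he_mem : ∀ t, e t ∈ middle s (s - 1) := by
    intro t
    have h1 := ha ⟨a + t, by omega⟩
    have h2 := hc ⟨a + t, by omega⟩
    simp only [middle, Finset.mem_Icc, e]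
    simp only at h1 h2
    omega
  have he : StrictMono e := by
    obtain hn | ⟨n, hn⟩ : c - a = 0 ∨ ∃ n, c - a = n + 1 := by
      rcases c - a with _ | n
      · exact Or.inl rfl
      · exact Or.inr ⟨n, rfl⟩
    · intro t; exact absurd t.2 (by omega)
    · intro t u htu
      have hlt : a + (t : ℕ) + 1 < m := by have := Fin.lt_def.1 htu; omega
      have h1 := hstep (a + t) hlt
      have h2 := hmono (show (⟨a + t + 1, hlt⟩ : Fin m) ≤ ⟨a + u, by omega⟩ by
        rw [Fin.le_def]; have := Fin.lt_def.1 htu; simp only; omega)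
      have h3 := he_mem t
      have h4 := he_mem u
      simp only [middle, Finset.mem_Icc, e] at h3 h4 ⊢
      omega
  let S : Finset ℕ := Finset.univ.image e
  have hcard : S.card = c - a := by
    rw [Finset.card_image_of_injective _ he.injective, Finset.card_univ, Fintype.card_fin]
  have hS : S ⊆ middle s (s - 1) := by
    intro x hx
    obtain ⟨t, -, rfl⟩ := Finset.mem_image.1 hx
    exact he_mem t
  have hemb : ∀ t : Fin S.card, S.orderEmbOfFin rfl t = i ⟨a + t, by omega⟩ := by
    intro t
    have := Finset.orderEmbOfFin_unique (s := S) (k := S.card) rfl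
      (f := fun t => e ⟨t, by omega⟩)
      (fun t => Finset.mem_image_of_mem _ (Finset.mem_univ _))
      (fun t u htu => he htu)
    exact (congrFun this t).symm
  refine ⟨S, hS, ?_, a, by omega, ?_⟩
  · refine middleBounded_of_pairs (by omega) fun t ht htn h1 h2 => ?_
    rw [← Finset.mem_coe, ← Finset.range_orderEmbOfFin S rfl] at h1 h2
    obtain ⟨u, hu⟩ := h1
    obtain ⟨v, hv⟩ := h2
    rw [middle, ← hu, ← hv, card_inter_Icc_orderEmbOfFin]
    have huv : u < v := by
      rw [← (S.orderEmbOfFin rfl).lt_iff_lt]; omega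
    have huv' := Fin.lt_def.1 huv
    have := hpair ⟨a + u, by omega⟩ ⟨a + v, by omega⟩ (by simp only; omega) (s + 1 - t)
      (by omega) (by omega) (by rw [← hemb, hu]) (by rw [← hemb, hv]; omega)
    simp only at this
    omega
  · funext p
    by_cases h1 : (p : ℕ) < a
    · rw [rowOf_of_lt h1]
      have := (ha p).2 h1
      have := hr p
      omega
    by_cases h2 : (p : ℕ) - a < S.card
    · rw [rowOf_of_middle (by omega) h2, hemb]
      congr 1
      ext
      simp only
      omega
    · rw [rowOf_of_ge (by omega)]
      have h3 := (hc p).not.2 (by omega)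
      have := hr p
      omega

/-- for `0 ≤ m ≤ s-1`,
`#B(m^1) = Σ_{k=0}^m (C(2s-2,k) - C(2s-2,k-2)) (m-k+1)`, where `C(n,j) = 0` for
`j < 0` (stated in `ℤ`). -/
theorem row_tableaux_count
    (s : ℕ) (hs : 3 ≤ s) (m : ℕ) (hm : m ≤ s - 1) :
    (({i : Fin m → ℕ | rowAdm s i}.ncard : ℤ)) =
      ∑ k ∈ Finset.range (m+1),
        (((2*s-2).choose k : ℤ) - (if 2 ≤ k then ((2*s-2).choose (k-2) : ℤ) else 0)) *
          ((m:ℤ) - (k:ℤ) + 1) := by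
  have hset : {i : Fin m → ℕ | rowAdm s i} =
      ((((middle s (s - 1)).powerset.filter
        (fun S => MiddleBounded s (s - 1) S ∧ S.card ≤ m)).sigma
          (fun S => Finset.range (m - S.card + 1))).image
            (fun x => rowOf s m x.1 x.2) : Finset (Fin m → ℕ)) := by
    ext i
    simp only [Set.mem_ofPred_eq, Finset.coe_image, Set.mem_image, Finset.mem_coe,
      Finset.mem_sigma, Finset.mem_filter, Finset.mem_powerset, Finset.mem_range]
    constructor
    · intro hi
      obtain ⟨S, hS, hB, a, ha, rfl⟩ := exists_rowOf_eq hs hi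
      exact ⟨⟨S, a⟩, ⟨⟨hS, hB, by simp only; omega⟩, by simp only; omega⟩, rfl⟩
    · rintro ⟨⟨S, a⟩, ⟨⟨hS, hB, -⟩, -⟩, rfl⟩
      exact rowAdm_rowOf hs hm hS hB a
  rw [hset, Set.ncard_coe_finset, Finset.card_image_of_injOn, Finset.card_sigma]
  swap
  · rintro ⟨S, a⟩ hx ⟨T, b⟩ hy hxy
    simp only [Finset.mem_coe, Finset.mem_sigma, Finset.mem_filter, Finset.mem_powerset,
      Finset.mem_range] at hx hy hxy
    obtain ⟨rfl, rfl⟩ := rowOf_injective (by omega) hx.1.1 hy.1.1 (by omega) (by omega) hxy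
    rfl
  rw [← Finset.sum_fiberwise_of_maps_to (t := Finset.range (m + 1)) (g := Finset.card)
    (fun S hS => by
      have := (Finset.mem_filter.1 hS).2.2
      rw [Finset.mem_range]; omega)]
  push_cast
  refine Finset.sum_congr rfl fun k hk => ?_
  have hk := Finset.mem_range.1 hk
  have hcount := card_middleBounded (s := s) (n := s - 1) (by omega) k
  rw [if_pos (by omega), show 2 * (s - 1) = 2 * s - 2 by omega, chooseDiff] at hcount
  rw [← hcount, Finset.filter_filter, ← nsmul_eq_mul, ← Finset.sum_const]
  refine Finset.sum_congr ?_ fun S hS => ?_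
  · refine Finset.filter_congr fun S _ => ?_
    rw [and_assoc]
    exact and_congr_right fun _ => by omega
  · have := (Finset.mem_filter.1 hS).2.2
    rw [Finset.card_range, this]
    push_cast [show k ≤ m by omega]
    ring

end CsBethe
end
end
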